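/- arXiv:1707.04411 — 7 statements merged into one kernel-verified Lean document; each statement's English description precedes it below -/
import Mathlib

section
/- Let d ≥ 1 and let U = {u_1, …, u_k} be a finite set of non-zero vectors in ℤ^d that generate ℤ^d as a group, and let U be the convex hull of U ∪ {0} in ℝ^d. Then for every δ > 0 there exists n_0 such that for every n ≥ n_0: (a) every finite set S ⊆ ℤ^d with |S| = n has vertex boundary ∂_v(S) ≥ (1−δ) d vol(U)^{1/d} n^{1−1/d}, and (b) some finite set S ⊆ ℤ^d with |S| = n has vertex boundary ∂_v(S) ≤ (1+δ) d vol(U)^{1/d} n^{1−1/d}. -/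
open Pointwise MeasureTheory

/-- Embedding of `ℤ^d` into `ℝ^d`. -/
def toReal' {d : ℕ} (v : Fin d → ℤ) : Fin d → ℝ := fun j => (v j : ℝ)

/-- Vertex boundary of a finite set `S ⊆ ℤ^d`: `|S + (U ∪ {0})| − |S|`. -/
noncomputable def vertexBdry {d k : ℕ} (u : Fin k → (Fin d → ℤ))
    (S : Finset (Fin d → ℤ)) : ℝ :=
  ((S + insert (0 : Fin d → ℤ) (Finset.univ.image u)).card : ℝ) - (S.card : ℝ)

section BrunnMinkowski

variable {ι : Type*}

/-- Nonempty half-open boxes in `ℝ^ι`. -/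
def IsHalfOpenBox (s : Set (ι → ℝ)) : Prop :=
  ∃ a b : ι → ℝ, (∀ i, a i < b i) ∧ s = Set.univ.pi fun i => Set.Ico (a i) (b i)

theorem pi_Ico_inter_lt (a b : ι → ℝ) (i : ι) (c : ℝ) [DecidableEq ι] :
    (Set.univ.pi fun j => Set.Ico (a j) (b j)) ∩ {x | x i < c} =
      Set.univ.pi fun j => Set.Ico (a j) (Function.update b i (min (b i) c) j) := by
  ext x
  simp only [Set.mem_inter_iff, Set.mem_univ_pi, Set.mem_Ico, Set.mem_ofPred_eq]
  constructor
  · rintro ⟨h, hc⟩ j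
    rcases eq_or_ne j i with rfl | hj
    · simp [h j, hc]
    · simp [hj, h j]
  · intro h
    have hi := h i
    simp only [Function.update_self, lt_min_iff] at hi
    refine ⟨fun j => ?_, hi.2.2⟩
    rcases eq_or_ne j i with rfl | hj
    · exact ⟨hi.1, hi.2.1⟩
    · simpa [hj] using h j

theorem pi_Ico_inter_ge (a b : ι → ℝ) (i : ι) (c : ℝ) [DecidableEq ι] :
    (Set.univ.pi fun j => Set.Ico (a j) (b j)) ∩ {x | x i < c}ᶜ =
      Set.univ.pi fun j => Set.Ico (Function.update a i (max (a i) c) j) (b j) := by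
  ext x
  simp only [Set.mem_inter_iff, Set.mem_univ_pi, Set.mem_Ico, Set.mem_ofPred_eq,
    Set.mem_compl_iff, not_lt]
  constructor
  · rintro ⟨h, hc⟩ j
    rcases eq_or_ne j i with rfl | hj
    · simp [h j, hc]
    · simp [hj, h j]
  · intro h
    have hi := h i
    simp only [Function.update_self, max_le_iff] at hi
    refine ⟨fun j => ?_, hi.1.2⟩
    rcases eq_or_ne j i with rfl | hj
    · exact ⟨hi.1.1, hi.2⟩
    · simpa [hj] using h j

theorem isHalfOpenBox_of_nonempty {a b : ι → ℝ}
    (h : (Set.univ.pi fun i => Set.Ico (a i) (b i)).Nonempty) :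
    IsHalfOpenBox (Set.univ.pi fun i => Set.Ico (a i) (b i)) := by
  obtain ⟨x, hx⟩ := h
  exact ⟨a, b, fun i => (hx i trivial).1.trans_lt (hx i trivial).2, rfl⟩

theorem IsHalfOpenBox.inter_lt {s : Set (ι → ℝ)} (hs : IsHalfOpenBox s) (i : ι) (c : ℝ)
    (h : (s ∩ {x | x i < c}).Nonempty) : IsHalfOpenBox (s ∩ {x | x i < c}) := by
  classical
  obtain ⟨a, b, -, rfl⟩ := hs
  rw [pi_Ico_inter_lt] at h ⊢
  exact isHalfOpenBox_of_nonempty h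

theorem IsHalfOpenBox.inter_ge {s : Set (ι → ℝ)} (hs : IsHalfOpenBox s) (i : ι) (c : ℝ)
    (h : (s ∩ {x | x i < c}ᶜ).Nonempty) : IsHalfOpenBox (s ∩ {x | x i < c}ᶜ) := by
  classical
  obtain ⟨a, b, -, rfl⟩ := hs
  rw [pi_Ico_inter_ge] at h ⊢
  exact isHalfOpenBox_of_nonempty h

theorem IsHalfOpenBox.nonempty {s : Set (ι → ℝ)} (hs : IsHalfOpenBox s) : s.Nonempty := by
  obtain ⟨a, b, hab, rfl⟩ := hs
  exact ⟨a, fun i _ => ⟨le_rfl, hab i⟩⟩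

theorem pi_Ico_add_pi_Ico {a b a' b' : ι → ℝ} (h : ∀ i, a i < b i) (h' : ∀ i, a' i < b' i) :
    (Set.univ.pi fun i => Set.Ico (a i) (b i)) + (Set.univ.pi fun i => Set.Ico (a' i) (b' i)) =
      Set.univ.pi fun i => Set.Ico ((a + a') i) ((b + b') i) := by
  ext x
  constructor
  · rintro ⟨y, hy, z, hz, rfl⟩ i -
    have h1 := hy i trivial
    have h2 := hz i trivial
    exact ⟨add_le_add h1.1 h2.1, add_lt_add h1.2 h2.2⟩
  · intro hx
    let t : ι → ℝ := fun i => (x i - a i - a' i) / (b i - a i + (b' i - a' i))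
    have ht : ∀ i, 0 ≤ t i ∧ t i < 1 ∧ t i * (b i - a i + (b' i - a' i)) = x i - a i - a' i := by
      intro i
      have hxi := hx i trivial
      simp only [Pi.add_apply, Set.mem_Ico] at hxi
      have hp : 0 < b i - a i + (b' i - a' i) := by linarith [h i, h' i]
      refine ⟨div_nonneg (by linarith) hp.le, ?_, ?_⟩
      · rw [div_lt_one hp]; linarith
      · exact div_mul_cancel₀ _ hp.ne'
    refine ⟨fun i => a i + t i * (b i - a i), fun i _ => ?_,
      fun i => a' i + t i * (b' i - a' i), fun i _ => ?_, ?_⟩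
    · obtain ⟨h0, h1, -⟩ := ht i
      have := h i
      constructor <;> nlinarith
    · obtain ⟨h0, h1, -⟩ := ht i
      have := h' i
      constructor <;> nlinarith
    · funext i
      obtain ⟨-, -, h2⟩ := ht i
      simp only [Pi.add_apply]
      linarith

theorem IsHalfOpenBox.add {s t : Set (ι → ℝ)} (hs : IsHalfOpenBox s) (ht : IsHalfOpenBox t) :
    IsHalfOpenBox (s + t) := by
  obtain ⟨a, b, hab, rfl⟩ := hs
  obtain ⟨a', b', hab', rfl⟩ := ht
  exact ⟨a + a', b + b', fun i => add_lt_add (hab i) (hab' i), pi_Ico_add_pi_Ico hab hab'⟩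

/-- `A` is the union of a finite disjoint family of at most `n` nonempty half-open boxes. -/
def IsBoxUnion (n : ℕ) (A : Set (ι → ℝ)) : Prop :=
  ∃ F : Finset (Set (ι → ℝ)), F.card ≤ n ∧ (∀ s ∈ F, IsHalfOpenBox s) ∧
    (F : Set (Set (ι → ℝ))).PairwiseDisjoint id ∧ A = ⋃ s ∈ F, s

/-- Restriction of a disjoint family of boxes to a set meeting each box in a box. -/
theorem isBoxUnion_inter {F : Finset (Set (ι → ℝ))}
    (hdis : (F : Set (Set (ι → ℝ))).PairwiseDisjoint id)
    (H : Set (ι → ℝ)) (hH : ∀ s ∈ F, (s ∩ H).Nonempty → IsHalfOpenBox (s ∩ H)) :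
    IsBoxUnion F.card ((⋃ s ∈ F, s) ∩ H) ∧
      ((∃ s ∈ F, s ∩ H = ∅) → IsBoxUnion (F.card - 1) ((⋃ s ∈ F, s) ∩ H)) := by
  classical
  let G : Finset (Set (ι → ℝ)) := (F.image (· ∩ H)).erase ∅
  have hbox : ∀ t ∈ G, IsHalfOpenBox t := by
    intro t ht
    obtain ⟨hne, ht⟩ := Finset.mem_erase.1 ht
    obtain ⟨s, hs, rfl⟩ := Finset.mem_image.1 ht
    exact hH s hs (Set.nonempty_iff_ne_empty.2 hne)
  have hG : (G : Set (Set (ι → ℝ))).PairwiseDisjoint id := by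
    intro t ht t' ht' hne
    obtain ⟨s, hs, rfl⟩ := Finset.mem_image.1 (Finset.mem_erase.1 ht).2
    obtain ⟨s', hs', rfl⟩ := Finset.mem_image.1 (Finset.mem_erase.1 ht').2
    have : s ≠ s' := by rintro rfl; exact hne rfl
    exact (hdis hs hs' this).mono Set.inter_subset_left Set.inter_subset_left
  have hU : (⋃ s ∈ F, s) ∩ H = ⋃ t ∈ G, t := by
    ext x
    simp only [Set.mem_inter_iff, Set.mem_iUnion, exists_prop, G, Finset.mem_erase,
      Finset.mem_image]
    constructor
    · rintro ⟨⟨s, hs, hx⟩, hxH⟩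
      exact ⟨s ∩ H, ⟨Set.nonempty_iff_ne_empty.1 ⟨x, hx, hxH⟩, s, hs, rfl⟩, hx, hxH⟩
    · rintro ⟨t, ⟨-, s, hs, rfl⟩, hx⟩
      exact ⟨⟨s, hs, hx.1⟩, hx.2⟩
  refine ⟨⟨G, ?_, hbox, hG, hU⟩, ?_⟩
  · exact (Finset.card_erase_le).trans Finset.card_image_le
  · rintro ⟨s, hs, hsH⟩
    refine ⟨G, ?_, hbox, hG, hU⟩
    rw [Finset.card_erase_of_mem (Finset.mem_image.2 ⟨s, hs, hsH⟩)]
    exact Nat.sub_le_sub_right Finset.card_image_le 1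

theorem IsBoxUnion.inter_lt {n : ℕ} {A : Set (ι → ℝ)} (hA : IsBoxUnion n A) (i : ι) (c : ℝ) :
    IsBoxUnion n (A ∩ {x | x i < c}) := by
  obtain ⟨F, hn, hF, hdis, rfl⟩ := hA
  obtain ⟨G, hG, h⟩ := (isBoxUnion_inter hdis _ fun s hs => (hF s hs).inter_lt i c).1
  exact ⟨G, hG.trans hn, h⟩

theorem IsBoxUnion.inter_ge {n : ℕ} {A : Set (ι → ℝ)} (hA : IsBoxUnion n A) (i : ι) (c : ℝ) :
    IsBoxUnion n (A ∩ {x | x i < c}ᶜ) := by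
  obtain ⟨F, hn, hF, hdis, rfl⟩ := hA
  obtain ⟨G, hG, h⟩ := (isBoxUnion_inter hdis _ fun s hs => (hF s hs).inter_ge i c).1
  exact ⟨G, hG.trans hn, h⟩

/-- Two distinct boxes of a disjoint family are separated by a coordinate hyperplane, which cuts
the union into two parts made of fewer boxes. -/
theorem exists_split {F : Finset (Set (ι → ℝ))} (hF : ∀ s ∈ F, IsHalfOpenBox s)
    (hdis : (F : Set (Set (ι → ℝ))).PairwiseDisjoint id) (hcard : 1 < F.card) :
    ∃ (i : ι) (c : ℝ), ((⋃ s ∈ F, s) ∩ {x | x i < c}).Nonempty ∧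
      ((⋃ s ∈ F, s) ∩ {x | x i < c}ᶜ).Nonempty ∧
      IsBoxUnion (F.card - 1) ((⋃ s ∈ F, s) ∩ {x | x i < c}) ∧
      IsBoxUnion (F.card - 1) ((⋃ s ∈ F, s) ∩ {x | x i < c}ᶜ) := by
  have key : ∃ s ∈ F, ∃ t ∈ F, ∃ (i : ι) (c : ℝ), s ⊆ {x | x i < c} ∧ t ⊆ {x | x i < c}ᶜ := by
    obtain ⟨s, hs, t, ht, hst⟩ := Finset.one_lt_card.1 hcard
    have hd : Disjoint s t := hdis hs ht hst
    obtain ⟨a, b, hab, rfl⟩ := hF s hs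
    obtain ⟨a', b', hab', rfl⟩ := hF t ht
    obtain ⟨i, hi⟩ := Set.disjoint_univ_pi.1 hd
    rw [Set.Ico_disjoint_Ico] at hi
    have : b i ≤ a' i ∨ b' i ≤ a i := by
      have h1 := hab i
      have h2 := hab' i
      rcases min_le_iff.1 hi with h | h <;> rcases le_max_iff.1 h with h | h
      · linarith
      · exact Or.inl h
      · exact Or.inr h
      · linarith
    rcases this with h | h
    · exact ⟨_, hs, _, ht, i, a' i, fun x hx => (hx i trivial).2.trans_le h,
        fun x hx => not_lt.2 (hx i trivial).1⟩
    · exact ⟨_, ht, _, hs, i, a i, fun x hx => (hx i trivial).2.trans_le h,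
        fun x hx => not_lt.2 (hx i trivial).1⟩
  obtain ⟨s, hs, t, ht, i, c, hsc, htc⟩ := key
  refine ⟨i, c, ?_, ?_, ?_, ?_⟩
  · obtain ⟨x, hx⟩ := (hF s hs).nonempty
    exact ⟨x, Set.mem_biUnion hs hx, hsc hx⟩
  · obtain ⟨x, hx⟩ := (hF t ht).nonempty
    exact ⟨x, Set.mem_biUnion ht hx, htc hx⟩
  · refine (isBoxUnion_inter hdis _ fun s hs => (hF s hs).inter_lt i c).2 ⟨t, ht, ?_⟩
    exact (Set.disjoint_left.2 fun x hx => htc hx).inter_eq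
  · refine (isBoxUnion_inter hdis _ fun s hs => (hF s hs).inter_ge i c).2 ⟨s, hs, ?_⟩
    exact (Set.disjoint_left.2 fun x hx h => Set.notMem_of_mem_compl h (hsc hx)).inter_eq

theorem measurableSet_coord_lt (i : ι) (c : ℝ) : MeasurableSet {x : ι → ℝ | x i < c} :=
  measurableSet_lt (measurable_pi_apply i) measurable_const

variable [Fintype ι]

theorem IsHalfOpenBox.measurableSet {s : Set (ι → ℝ)} (hs : IsHalfOpenBox s) :
    MeasurableSet s := by
  obtain ⟨a, b, -, rfl⟩ := hs
  exact MeasurableSet.univ_pi fun i => measurableSet_Ico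

theorem IsHalfOpenBox.isBounded {s : Set (ι → ℝ)} (hs : IsHalfOpenBox s) :
    Bornology.IsBounded s := by
  obtain ⟨a, b, -, rfl⟩ := hs
  refine (Metric.isBounded_Icc a b).subset fun x hx => ?_
  exact ⟨fun i => (hx i trivial).1, fun i => (hx i trivial).2.le⟩

theorem IsHalfOpenBox.volume_real_pos {s : Set (ι → ℝ)} (hs : IsHalfOpenBox s) :
    0 < volume.real s := by
  obtain ⟨a, b, hab, rfl⟩ := hs
  rw [Measure.real, Real.volume_pi_Ico_toReal fun i => (hab i).le]
  exact Finset.prod_pos fun i _ => sub_pos.2 (hab i)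

theorem IsHalfOpenBox.continuous_volume_inter_lt {s : Set (ι → ℝ)} (hs : IsHalfOpenBox s) (i : ι) :
    Continuous fun c : ℝ => volume.real (s ∩ {x | x i < c}) := by
  classical
  obtain ⟨a, b, -, rfl⟩ := hs
  simp only [pi_Ico_inter_lt, Measure.real, Real.volume_pi_Ico, ENNReal.toReal_prod,
    ENNReal.toReal_ofReal']
  refine continuous_finsetProd _ fun j _ => ?_
  rcases eq_or_ne j i with rfl | hj
  · simp only [Function.update_self]
    fun_prop
  · simp only [Function.update_of_ne hj]
    fun_prop

theorem prod_rpow_add_prod_rpow_le [Nonempty ι] {p q : ι → ℝ} (hp : ∀ i, 0 < p i)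
    (hq : ∀ i, 0 < q i) :
    (∏ i, p i) ^ ((1 : ℝ) / Fintype.card ι) + (∏ i, q i) ^ ((1 : ℝ) / Fintype.card ι) ≤
      (∏ i, (p i + q i)) ^ ((1 : ℝ) / Fintype.card ι) := by
  have hcard : (0 : ℝ) < Fintype.card ι := by exact_mod_cast Fintype.card_pos
  have hpq : ∀ i, 0 < p i + q i := fun i => add_pos (hp i) (hq i)
  have key : ∀ r : ι → ℝ, (∀ i, 0 < r i) →
      (∏ i, r i) ^ ((1 : ℝ) / Fintype.card ι) ≤
        (∑ i, (1 : ℝ) / Fintype.card ι * (r i / (p i + q i))) *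
          (∏ i, (p i + q i)) ^ ((1 : ℝ) / Fintype.card ι) := by
    intro r hr
    have h := Real.geom_mean_le_arith_mean_weighted Finset.univ
      (fun _ : ι => (1 : ℝ) / Fintype.card ι) (fun i => r i / (p i + q i))
      (fun i _ => by positivity) (by simp [hcard.ne'])
      (fun i _ => (div_pos (hr i) (hpq i)).le)
    rw [Real.finsetProd_rpow _ _ fun i _ => (div_pos (hr i) (hpq i)).le] at h
    calc (∏ i, r i) ^ ((1 : ℝ) / Fintype.card ι)
        = (∏ i, r i / (p i + q i)) ^ ((1 : ℝ) / Fintype.card ι) *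
          (∏ i, (p i + q i)) ^ ((1 : ℝ) / Fintype.card ι) := by
          rw [← Real.mul_rpow (Finset.prod_nonneg fun i _ => (div_pos (hr i) (hpq i)).le)
            (Finset.prod_nonneg fun i _ => (hpq i).le), ← Finset.prod_mul_distrib]
          congr 2 with i
          rw [div_mul_cancel₀ _ (hpq i).ne']
      _ ≤ _ := by
          gcongr
          exact Real.rpow_nonneg (Finset.prod_nonneg fun i _ => (hpq i).le) _
  refine (add_le_add (key p hp) (key q hq)).trans_eq ?_
  rw [← add_mul, ← Finset.sum_add_distrib]
  have : ∀ i, (1 : ℝ) / Fintype.card ι * (p i / (p i + q i)) +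
      1 / Fintype.card ι * (q i / (p i + q i)) = 1 / Fintype.card ι := by
    intro i
    rw [← mul_add, ← add_div, div_self (hpq i).ne', mul_one]
  simp only [this]
  simp [hcard.ne']

theorem IsHalfOpenBox.brunn_minkowski [Nonempty ι] {s t : Set (ι → ℝ)} (hs : IsHalfOpenBox s)
    (ht : IsHalfOpenBox t) :
    volume.real s ^ ((1 : ℝ) / Fintype.card ι) + volume.real t ^ ((1 : ℝ) / Fintype.card ι) ≤
      volume.real (s + t) ^ ((1 : ℝ) / Fintype.card ι) := by
  obtain ⟨a, b, hab, rfl⟩ := hs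
  obtain ⟨a', b', hab', rfl⟩ := ht
  rw [pi_Ico_add_pi_Ico hab hab', Measure.real, Measure.real, Measure.real,
    Real.volume_pi_Ico_toReal fun i => (hab i).le, Real.volume_pi_Ico_toReal fun i => (hab' i).le,
    Real.volume_pi_Ico_toReal (a := a + a') (b := b + b')
      fun i => (add_lt_add (hab i) (hab' i)).le]
  refine (prod_rpow_add_prod_rpow_le (fun i => sub_pos.2 (hab i))
    fun i => sub_pos.2 (hab' i)).trans_eq ?_
  congr 2 with i
  simp only [Pi.add_apply]
  ring

theorem IsBoxUnion.measurableSet {n : ℕ} {A : Set (ι → ℝ)} (hA : IsBoxUnion n A) :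
    MeasurableSet A := by
  obtain ⟨F, -, hF, -, rfl⟩ := hA
  exact F.measurableSet_biUnion fun s hs => (hF s hs).measurableSet

theorem IsBoxUnion.isBounded {n : ℕ} {A : Set (ι → ℝ)} (hA : IsBoxUnion n A) :
    Bornology.IsBounded A := by
  obtain ⟨F, -, hF, -, rfl⟩ := hA
  exact (Bornology.isBounded_biUnion_finset F).2 fun s hs => (hF s hs).isBounded

theorem IsBoxUnion.volume_ne_top {n : ℕ} {A : Set (ι → ℝ)} (hA : IsBoxUnion n A) :
    volume A ≠ ⊤ := hA.isBounded.measure_lt_top.ne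

theorem IsBoxUnion.measurableSet_add {m n : ℕ} {A B : Set (ι → ℝ)} (hA : IsBoxUnion m A)
    (hB : IsBoxUnion n B) : MeasurableSet (A + B) := by
  obtain ⟨F, -, hF, -, rfl⟩ := hA
  obtain ⟨G, -, hG, -, rfl⟩ := hB
  simp only [Set.iUnion_add, Set.add_iUnion]
  exact G.measurableSet_biUnion fun t ht => F.measurableSet_biUnion fun s hs =>
    ((hF s hs).add (hG t ht)).measurableSet

theorem IsBoxUnion.volume_add_ne_top {m n : ℕ} {A B : Set (ι → ℝ)} (hA : IsBoxUnion m A)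
    (hB : IsBoxUnion n B) : volume (A + B) ≠ ⊤ :=
  (hA.isBounded.add hB.isBounded).measure_lt_top.ne

theorem IsBoxUnion.volume_real_pos {n : ℕ} {A : Set (ι → ℝ)} (hA : IsBoxUnion n A)
    (hne : A.Nonempty) : 0 < volume.real A := by
  have hfin := hA.volume_ne_top
  obtain ⟨F, -, hF, -, rfl⟩ := hA
  obtain ⟨x, hx⟩ := hne
  obtain ⟨s, hs, -⟩ := Set.mem_iUnion₂.1 hx
  exact (hF s hs).volume_real_pos.trans_le
    (measureReal_mono (Set.subset_biUnion_of_mem (u := fun s => s) hs) hfin)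

theorem IsBoxUnion.continuous_volume_inter_lt {n : ℕ} {A : Set (ι → ℝ)} (hA : IsBoxUnion n A)
    (i : ι) : Continuous fun c : ℝ => volume.real (A ∩ {x | x i < c}) := by
  obtain ⟨F, -, hF, hdis, rfl⟩ := hA
  have : ∀ c : ℝ, volume.real ((⋃ s ∈ F, s) ∩ {x | x i < c}) =
      ∑ s ∈ F, volume.real (s ∩ {x | x i < c}) := by
    intro c
    rw [Set.iUnion₂_inter]
    refine measureReal_biUnion_finset ?_ ?_ ?_
    · exact fun s hs t ht hst => (hdis hs ht hst).mono Set.inter_subset_left Set.inter_subset_left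
    · exact fun s hs => (hF s hs).measurableSet.inter (measurableSet_coord_lt i c)
    · exact fun s hs => ((hF s hs).isBounded.subset Set.inter_subset_left).measure_lt_top.ne
  simp only [this]
  exact continuous_finsetSum _ fun s hs => (hF s hs).continuous_volume_inter_lt i

theorem IsBoxUnion.exists_volume_inter_lt_eq {n : ℕ} {A : Set (ι → ℝ)} (hA : IsBoxUnion n A)
    (i : ι) {v : ℝ} (h0 : 0 ≤ v) (hv : v ≤ volume.real A) :
    ∃ c : ℝ, volume.real (A ∩ {x | x i < c}) = v := by
  obtain ⟨R, hR⟩ := hA.isBounded.exists_norm_le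
  have hR' : ∀ x ∈ A, |x i| ≤ R := fun x hx => (norm_le_pi_norm x i).trans (hR x hx)
  refine mem_range_of_exists_le_of_exists_ge (hA.continuous_volume_inter_lt i) ⟨-R, ?_⟩ ⟨R + 1, ?_⟩
  · have : A ∩ {x | x i < -R} = ∅ := by
      ext x
      simp only [Set.mem_inter_iff, Set.mem_ofPred_eq, Set.mem_empty_iff_false, iff_false, not_and,
        not_lt]
      exact fun hx => (abs_le.1 (hR' x hx)).1
    simpa [this] using h0
  · have : A ∩ {x | x i < R + 1} = A :=
      Set.inter_eq_left.2 fun x hx => ((abs_le.1 (hR' x hx)).2).trans_lt (lt_add_one R)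
    simpa [this] using hv

theorem volume_real_inter_add_compl {A : Set (ι → ℝ)} (hA : volume A ≠ ⊤) (i : ι) (c : ℝ) :
    volume.real (A ∩ {x | x i < c}) + volume.real (A ∩ {x | x i < c}ᶜ) = volume.real A := by
  rw [← Set.sdiff_eq]
  exact measureReal_inter_add_sdiff (measurableSet_coord_lt i c) hA

/-- Inductive step of the Hadwiger–Ohmann argument. -/
theorem brunn_minkowski_of_split [Nonempty ι] {p q : ℕ} {A B : Set (ι → ℝ)} (hA : IsBoxUnion p A)
    (hB : IsBoxUnion q B) (hBne : B.Nonempty) {i : ι} {c : ℝ}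
    (hlt : (A ∩ {x | x i < c}).Nonempty) (hge : (A ∩ {x | x i < c}ᶜ).Nonempty)
    (ih : ∀ B' : Set (ι → ℝ), IsBoxUnion q B' → B'.Nonempty →
      volume.real (A ∩ {x | x i < c}) ^ ((1 : ℝ) / Fintype.card ι) +
          volume.real B' ^ ((1 : ℝ) / Fintype.card ι) ≤
        volume.real (A ∩ {x | x i < c} + B') ^ ((1 : ℝ) / Fintype.card ι) ∧
      volume.real (A ∩ {x | x i < c}ᶜ) ^ ((1 : ℝ) / Fintype.card ι) +
          volume.real B' ^ ((1 : ℝ) / Fintype.card ι) ≤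
        volume.real (A ∩ {x | x i < c}ᶜ + B') ^ ((1 : ℝ) / Fintype.card ι)) :
    volume.real A ^ ((1 : ℝ) / Fintype.card ι) + volume.real B ^ ((1 : ℝ) / Fintype.card ι) ≤
      volume.real (A + B) ^ ((1 : ℝ) / Fintype.card ι) := by
  set e : ℝ := (1 : ℝ) / Fintype.card ι with he
  have hN : Fintype.card ι ≠ 0 := Fintype.card_ne_zero
  have hpow : ∀ x : ℝ, 0 ≤ x → (x ^ e) ^ Fintype.card ι = x := fun x hx => by
    rw [he, one_div]; exact Real.rpow_inv_natCast_pow hx hN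
  have hA1 : IsBoxUnion p (A ∩ {x | x i < c}) := hA.inter_lt i c
  have hA2 : IsBoxUnion p (A ∩ {x | x i < c}ᶜ) := hA.inter_ge i c
  have hv1 := hA1.volume_real_pos hlt
  have hv2 := hA2.volume_real_pos hge
  have hvA := volume_real_inter_add_compl hA.volume_ne_top i c
  have hB0 := hB.volume_real_pos hBne
  set α := volume.real A with hα
  set β := volume.real B with hβ
  have hα0 : 0 < α := by linarith
  obtain ⟨θ, hθ⟩ : ∃ θ, θ = volume.real (A ∩ {x | x i < c}) / α := ⟨_, rfl⟩
  have hθ0 : 0 < θ := hθ ▸ div_pos hv1 hα0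
  have hθ1 : θ < 1 := by rw [hθ, div_lt_one hα0]; linarith
  have e1 : volume.real (A ∩ {x | x i < c}) = θ * α := by rw [hθ, div_mul_cancel₀ _ hα0.ne']
  have e2 : volume.real (A ∩ {x | x i < c}ᶜ) = (1 - θ) * α := by linarith
  obtain ⟨c', hc'⟩ := hB.exists_volume_inter_lt_eq i (v := θ * β) (by positivity) (by nlinarith)
  have hvB := volume_real_inter_add_compl hB.volume_ne_top i c'
  have hc'' : volume.real (B ∩ {x | x i < c'}ᶜ) = (1 - θ) * β := by linarith
  have hB1 : IsBoxUnion q (B ∩ {x | x i < c'}) := hB.inter_lt i c'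
  have hB2 : IsBoxUnion q (B ∩ {x | x i < c'}ᶜ) := hB.inter_ge i c'
  have hn1 : (B ∩ {x | x i < c'}).Nonempty := by
    rw [Set.nonempty_iff_ne_empty]
    intro h
    rw [h, measureReal_empty] at hc'
    exact (mul_pos hθ0 hB0).ne hc'
  have hn2 : (B ∩ {x | x i < c'}ᶜ).Nonempty := by
    rw [Set.nonempty_iff_ne_empty]
    intro h
    rw [h, measureReal_empty] at hc''
    exact (mul_pos (sub_pos.2 hθ1) hB0).ne hc''
  have i1 := (ih _ hB1 hn1).1
  have i2 := (ih _ hB2 hn2).2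
  have hsub : ∀ τ : ℝ, 0 < τ → ∀ w : ℝ, 0 ≤ w → (τ * α) ^ e + (τ * β) ^ e ≤ w ^ e →
      τ * (α ^ e + β ^ e) ^ Fintype.card ι ≤ w := by
    intro τ hτ w hw h
    rw [Real.mul_rpow hτ.le hα0.le, Real.mul_rpow hτ.le hB0.le, ← mul_add] at h
    have := pow_le_pow_left₀ (by positivity) h (Fintype.card ι)
    rwa [mul_pow, hpow _ hτ.le, hpow _ hw] at this
  rw [e1, hc'] at i1
  rw [e2, hc''] at i2
  have j1 := hsub θ hθ0 _ measureReal_nonneg i1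
  have j2 := hsub (1 - θ) (sub_pos.2 hθ1) _ measureReal_nonneg i2
  have hdisj : Disjoint (A ∩ {x | x i < c} + B ∩ {x | x i < c'})
      (A ∩ {x | x i < c}ᶜ + B ∩ {x | x i < c'}ᶜ) := by
    rw [Set.disjoint_left]
    rintro _ ⟨x, hx, y, hy, rfl⟩ ⟨x', hx', y', hy', h⟩
    have h3 : x i < c := hx.2
    have h4 : y i < c' := hy.2
    have h5 : c ≤ x' i := not_lt.1 hx'.2
    have h6 : c' ≤ y' i := not_lt.1 hy'.2
    have h7 : x' i + y' i = x i + y i := congrFun h i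
    linarith
  have hle : volume.real (A ∩ {x | x i < c} + B ∩ {x | x i < c'}) +
      volume.real (A ∩ {x | x i < c}ᶜ + B ∩ {x | x i < c'}ᶜ) ≤ volume.real (A + B) := by
    rw [← measureReal_union hdisj (hA2.measurableSet_add hB2) (hA1.volume_add_ne_top hB1)
      (hA2.volume_add_ne_top hB2)]
    refine measureReal_mono (Set.union_subset ?_ ?_) (hA.volume_add_ne_top hB)
    · exact Set.add_subset_add Set.inter_subset_left Set.inter_subset_left
    · exact Set.add_subset_add Set.inter_subset_left Set.inter_subset_left
  have hfinal : (α ^ e + β ^ e) ^ Fintype.card ι ≤ volume.real (A + B) := by nlinarith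
  refine le_of_pow_le_pow_left₀ hN (Real.rpow_nonneg measureReal_nonneg _) ?_
  rwa [hpow _ measureReal_nonneg]

/-- **Brunn–Minkowski inequality** for finite unions of boxes. -/
theorem IsBoxUnion.brunn_minkowski [Nonempty ι] {m n : ℕ} {A B : Set (ι → ℝ)}
    (hA : IsBoxUnion m A) (hB : IsBoxUnion n B) (hAne : A.Nonempty) (hBne : B.Nonempty) :
    volume.real A ^ ((1 : ℝ) / Fintype.card ι) + volume.real B ^ ((1 : ℝ) / Fintype.card ι) ≤
      volume.real (A + B) ^ ((1 : ℝ) / Fintype.card ι) := by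
  induction hN : m + n using Nat.strong_induction_on generalizing m n A B with
  | _ N IH =>
  subst hN
  have hA' := hA
  have hB' := hB
  obtain ⟨F, hFm, hF, hFdis, hAF⟩ := hA
  obtain ⟨G, hGn, hG, hGdis, hBG⟩ := hB
  by_cases hF1 : 1 < F.card
  · obtain ⟨i, c, hlt, hge, h1, h2⟩ := exists_split hF hFdis hF1
    rw [← hAF] at hlt hge h1 h2
    refine brunn_minkowski_of_split hA' hB' hBne hlt hge fun B' hB'' hne => ⟨?_, ?_⟩
    · exact IH _ (by omega) h1 hB'' hlt hne rfl
    · exact IH _ (by omega) h2 hB'' hge hne rfl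
  by_cases hG1 : 1 < G.card
  · obtain ⟨i, c, hlt, hge, h1, h2⟩ := exists_split hG hGdis hG1
    rw [← hBG] at hlt hge h1 h2
    rw [add_comm, add_comm A B]
    refine brunn_minkowski_of_split hB' hA' hAne hlt hge fun A' hA'' hne => ⟨?_, ?_⟩
    · exact IH _ (by omega) h1 hA'' hlt hne rfl
    · exact IH _ (by omega) h2 hA'' hge hne rfl
  have single : ∀ {F : Finset (Set (ι → ℝ))} {A : Set (ι → ℝ)}, A.Nonempty → A = ⋃ s ∈ F, s →
      (∀ s ∈ F, IsHalfOpenBox s) → ¬ 1 < F.card → IsHalfOpenBox A := by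
    rintro F A ⟨x, hx⟩ rfl hF h
    obtain ⟨s, hs, -⟩ := Set.mem_iUnion₂.1 hx
    obtain rfl : F = {s} :=
      Finset.eq_singleton_iff_unique_mem.2
        ⟨hs, fun t ht => Finset.card_le_one.1 (not_lt.1 h) t ht s hs⟩
    simpa using hF s hs
  exact (single hAne hAF hF hF1).brunn_minkowski (single hBne hBG hG hG1)

end BrunnMinkowski

section LatticeSumsets

variable {d : ℕ}

/-- The half-open unit cube with lowest corner `p`. -/
def unitCube (p : Fin d → ℤ) : Set (Fin d → ℝ) :=
  Set.univ.pi fun i => Set.Ico (p i : ℝ) (p i + 1)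

theorem mem_unitCube_iff {p : Fin d → ℤ} {x : Fin d → ℝ} :
    x ∈ unitCube p ↔ ∀ i, ⌊x i⌋ = p i := by
  simp [unitCube, Int.floor_eq_iff]

theorem isHalfOpenBox_unitCube (p : Fin d → ℤ) : IsHalfOpenBox (unitCube p) :=
  ⟨fun i => p i, fun i => p i + 1, fun _ => lt_add_one _, rfl⟩

theorem volume_real_unitCube (p : Fin d → ℤ) : volume.real (unitCube p) = 1 := by
  rw [unitCube, Measure.real, Real.volume_pi_Ico_toReal fun i => (lt_add_one (p i : ℝ)).le]
  simp

theorem pairwiseDisjoint_unitCube (A : Set (Fin d → ℤ)) : A.PairwiseDisjoint unitCube := by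
  intro p _ q _ hpq
  refine Set.disjoint_left.2 fun x hx hx' => hpq ?_
  funext i
  rw [← mem_unitCube_iff.1 hx i, mem_unitCube_iff.1 hx' i]

theorem isBoxUnion_unitCubes (A : Finset (Fin d → ℤ)) :
    IsBoxUnion A.card (⋃ p ∈ A, unitCube p) := by
  classical
  refine ⟨A.image unitCube, Finset.card_image_le, ?_, ?_, by simp⟩
  · intro s hs
    obtain ⟨p, -, rfl⟩ := Finset.mem_image.1 hs
    exact isHalfOpenBox_unitCube p
  · intro s hs t ht hst
    obtain ⟨p, hp, rfl⟩ := Finset.mem_image.1 hs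
    obtain ⟨q, hq, rfl⟩ := Finset.mem_image.1 ht
    exact pairwiseDisjoint_unitCube A hp hq fun h => hst (congrArg unitCube h)

theorem volume_real_unitCubes (A : Finset (Fin d → ℤ)) :
    volume.real (⋃ p ∈ A, unitCube p) = A.card := by
  rw [measureReal_biUnion_finset (pairwiseDisjoint_unitCube _)
    (fun p _ => (isHalfOpenBox_unitCube p).measurableSet)
    (fun p _ => (isHalfOpenBox_unitCube p).isBounded.measure_lt_top.ne)]
  simp [volume_real_unitCube]

/-- Vertices of the discrete unit cube. -/
def cubeVertices (d : ℕ) : Finset (Fin d → ℤ) := Fintype.piFinset fun _ => {0, 1}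

theorem unitCubes_add_subset (A B : Finset (Fin d → ℤ)) :
    (⋃ p ∈ A, unitCube p) + (⋃ p ∈ B, unitCube p) ⊆
      ⋃ p ∈ A + B + cubeVertices d, unitCube p := by
  rintro _ ⟨x, hx, y, hy, rfl⟩
  obtain ⟨p, hp, hxp⟩ := Set.mem_iUnion₂.1 hx
  obtain ⟨q, hq, hyq⟩ := Set.mem_iUnion₂.1 hy
  refine Set.mem_iUnion₂.2 ⟨fun i => ⌊x i + y i⌋, ?_, mem_unitCube_iff.2 fun i => rfl⟩
  have : (fun i => ⌊x i + y i⌋) = p + q + fun i => ⌊x i + y i⌋ - p i - q i := by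
    funext i
    simp only [Pi.add_apply]
    ring
  rw [this]
  refine Finset.add_mem_add (Finset.add_mem_add hp hq) (Fintype.mem_piFinset.2 fun i => ?_)
  have h1 := mem_unitCube_iff.1 hxp i
  have h2 := mem_unitCube_iff.1 hyq i
  have h3 := Int.le_floor_add (x i) (y i)
  have h4 := Int.le_floor_add_floor (x i) (y i)
  simp only [Finset.mem_insert, Finset.mem_singleton]
  omega

/-- Discrete **Brunn–Minkowski inequality** in `ℤ^d`. -/
theorem card_rpow_add_card_rpow_le (hd : 1 ≤ d) {A B : Finset (Fin d → ℤ)} (hA : A.Nonempty)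
    (hB : B.Nonempty) :
    (A.card : ℝ) ^ ((1 : ℝ) / d) + (B.card : ℝ) ^ ((1 : ℝ) / d) ≤
      ((A + B + cubeVertices d).card : ℝ) ^ ((1 : ℝ) / d) := by
  have : Nonempty (Fin d) := ⟨⟨0, hd⟩⟩
  have hne : ∀ {A : Finset (Fin d → ℤ)}, A.Nonempty → (⋃ p ∈ A, unitCube p).Nonempty := by
    rintro A ⟨p, hp⟩
    obtain ⟨x, hx⟩ := (isHalfOpenBox_unitCube p).nonempty
    exact ⟨x, Set.mem_biUnion hp hx⟩
  have h := (isBoxUnion_unitCubes A).brunn_minkowski (isBoxUnion_unitCubes B) (hne hA) (hne hB)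
  rw [volume_real_unitCubes, volume_real_unitCubes, Fintype.card_fin] at h
  refine h.trans (Real.rpow_le_rpow measureReal_nonneg ?_ (by positivity))
  rw [← volume_real_unitCubes]
  exact measureReal_mono (unitCubes_add_subset A B) (isBoxUnion_unitCubes _).volume_ne_top

/-- The `n`-fold sumset `B + ⋯ + B`. -/
def iterSumset (B : Finset (Fin d → ℤ)) : ℕ → Finset (Fin d → ℤ)
  | 0 => {0}
  | n + 1 => iterSumset B n + B

theorem iterSumset_add (B : Finset (Fin d → ℤ)) (m n : ℕ) :
    iterSumset B (m + n) = iterSumset B m + iterSumset B n := by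
  induction n with
  | zero => rw [iterSumset, Finset.singleton_zero, add_zero, add_zero]
  | succ n ih => rw [← add_assoc, iterSumset, iterSumset, ih, add_assoc]

theorem iterSumset_nonempty {B : Finset (Fin d → ℤ)} (hB : B.Nonempty) (n : ℕ) :
    (iterSumset B n).Nonempty := by
  induction n with
  | zero => exact Finset.singleton_nonempty 0
  | succ n ih => exact ih.add hB

theorem iterSumset_mono {B : Finset (Fin d → ℤ)} (h0 : (0 : Fin d → ℤ) ∈ B) :
    Monotone (iterSumset B) := by
  refine monotone_nat_of_le_succ fun n x hx => ?_
  rw [← add_zero x]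
  exact Finset.add_mem_add hx h0

theorem nsmul_mem_iterSumset {B : Finset (Fin d → ℤ)} {b : Fin d → ℤ} (hb : b ∈ B) (n : ℕ) :
    n • b ∈ iterSumset B n := by
  induction n with
  | zero => simp [iterSumset]
  | succ n ih => rw [succ_nsmul]; exact Finset.add_mem_add ih hb

theorem sum_nsmul_mem_iterSumset {κ : Type*} {B : Finset (Fin d → ℤ)} {v : κ → Fin d → ℤ}
    (hv : ∀ i, v i ∈ B) (s : Finset κ) (a : κ → ℕ) :
    ∑ i ∈ s, a i • v i ∈ iterSumset B (∑ i ∈ s, a i) := by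
  classical
  induction s using Finset.induction_on with
  | empty => simp [iterSumset]
  | insert i s hi ih =>
    rw [Finset.sum_insert hi, Finset.sum_insert hi, iterSumset_add]
    exact Finset.add_mem_add (nsmul_mem_iterSumset (hv i) _) ih

/-- Every finite set is contained, up to translation, in some iterated sumset of a generating
set. -/
theorem exists_translate_subset_iterSumset {k : ℕ} {u : Fin k → (Fin d → ℤ)}
    {B : Finset (Fin d → ℤ)} (h0 : (0 : Fin d → ℤ) ∈ B) (huB : ∀ i, u i ∈ B)
    (hgen : AddSubgroup.closure (Set.range u) = ⊤) (T : Finset (Fin d → ℤ)) :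
    ∃ (c : ℕ) (p : Fin d → ℤ), ∀ x ∈ T, x + p ∈ iterSumset B c := by
  have hrep : ∀ x : Fin d → ℤ, ∃ a : Fin k → ℤ, ∑ i, a i • u i = x := by
    intro x
    rw [← Submodule.mem_span_range_iff_exists_fun ℤ, ← Submodule.mem_toAddSubgroup,
      Submodule.span_int_eq_addSubgroupClosure, hgen]
    trivial
  choose a ha using hrep
  let N : ℕ := ∑ x ∈ T, ∑ i, (a x i).natAbs
  have hN : ∀ x ∈ T, ∀ i, 0 ≤ a x i + N := by
    intro x hx i
    have h1 : (a x i).natAbs ≤ ∑ i, (a x i).natAbs :=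
      Finset.single_le_sum (f := fun i => (a x i).natAbs) (fun _ _ => Nat.zero_le _)
        (Finset.mem_univ i)
    have h2 : ∑ i, (a x i).natAbs ≤ N :=
      Finset.single_le_sum (f := fun x => ∑ i, (a x i).natAbs) (fun _ _ => Nat.zero_le _) hx
    omega
  refine ⟨∑ x ∈ T, ∑ i, (a x i + N).toNat, ∑ i, N • u i, fun x hx => ?_⟩
  have hle : ∑ i, (a x i + N).toNat ≤ ∑ x ∈ T, ∑ i, (a x i + N).toNat :=
    Finset.single_le_sum (f := fun x => ∑ i, (a x i + N).toNat) (fun _ _ => Nat.zero_le _) hx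
  have hx' : x + ∑ i, N • u i = ∑ i, (a x i + N).toNat • u i := by
    conv_lhs => rw [← ha x]
    rw [← Finset.sum_add_distrib]
    refine Finset.sum_congr rfl fun i _ => ?_
    rw [← natCast_zsmul (u i) (a x i + N).toNat, Int.toNat_of_nonneg (hN x hx i), add_smul,
      natCast_zsmul]
  rw [hx']
  exact iterSumset_mono h0 hle (sum_nsmul_mem_iterSumset huB _ _)

/-- Superadditivity up to a bounded shift of the `d`-th root of sumset sizes. -/
theorem card_rpow_add_card_iterSumset_rpow_le (hd : 1 ≤ d) {B : Finset (Fin d → ℤ)} {c : ℕ}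
    {p : Fin d → ℤ} (hB : B.Nonempty) (hc : ∀ x ∈ cubeVertices d, x + p ∈ iterSumset B c)
    {A : Finset (Fin d → ℤ)} (hA : A.Nonempty) (m : ℕ) :
    (A.card : ℝ) ^ ((1 : ℝ) / d) + ((iterSumset B m).card : ℝ) ^ ((1 : ℝ) / d) ≤
      ((A + iterSumset B (m + c)).card : ℝ) ^ ((1 : ℝ) / d) := by
  refine (card_rpow_add_card_rpow_le hd hA (iterSumset_nonempty hB m)).trans
    (Real.rpow_le_rpow (by positivity) ?_ (by positivity))
  rw [iterSumset_add, ← add_assoc, ← Finset.card_add_singleton _ p, add_assoc _ (cubeVertices d)]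
  refine mod_cast Finset.card_le_card (Finset.add_subset_add_left ?_)
  intro y hy
  obtain ⟨x, hx, q, hq, rfl⟩ := Finset.mem_add.1 hy
  rw [Finset.mem_singleton.1 hq]
  exact hc x hx

/-- **Plünnecke's inequality** in Petridis' form, with iterated sumsets. -/
theorem exists_card_add_iterSumset_le {A : Finset (Fin d → ℤ)} (hA : A.Nonempty)
    (B : Finset (Fin d → ℤ)) :
    ∃ A' ⊆ A, A'.Nonempty ∧ ∀ m : ℕ,
      ((A' + iterSumset B m).card : ℝ) ≤ (((A + B).card : ℝ) / A.card) ^ m * A'.card := by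
  obtain ⟨X, hX, hmin⟩ := Finset.exists_min_image (A.powerset.erase ∅)
    (fun X => ((X + B).card : ℝ) / X.card)
    ⟨A, Finset.mem_erase.2 ⟨hA.ne_empty, Finset.mem_powerset_self A⟩⟩
  obtain ⟨hXne, hXA⟩ := Finset.mem_erase.1 hX
  have hXA := Finset.mem_powerset.1 hXA
  have hXne := Finset.nonempty_iff_ne_empty.2 hXne
  have hXpos : (0 : ℝ) < X.card := by exact_mod_cast hXne.card_pos
  have hpet : ∀ Y ⊆ X, (X + B).card * Y.card ≤ (Y + B).card * X.card := by
    intro Y hY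
    rcases Y.eq_empty_or_nonempty with rfl | hYne
    · simp
    have hYpos : (0 : ℝ) < Y.card := by exact_mod_cast hYne.card_pos
    have := hmin Y (Finset.mem_erase.2 ⟨hYne.ne_empty, Finset.mem_powerset.2 (hY.trans hXA)⟩)
    rw [div_le_div_iff₀ hXpos hYpos] at this
    exact_mod_cast this
  refine ⟨X, hXA, hXne, fun m => ?_⟩
  have hr := hmin A (Finset.mem_erase.2 ⟨hA.ne_empty, Finset.mem_powerset_self A⟩)
  induction m with
  | zero => simp [iterSumset]
  | succ m ih =>
    have h := Finset.pluennecke_petridis_inequality_add (iterSumset B m) hpet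
    have h' : ((X + iterSumset B (m + 1)).card : ℝ) * X.card ≤
        (X + B).card * (X + iterSumset B m).card := by
      rw [iterSumset, ← add_assoc, add_comm X]
      exact_mod_cast h
    rw [← le_div_iff₀ hXpos, mul_div_right_comm] at h'
    refine h'.trans ?_
    rw [pow_succ', mul_assoc]
    exact mul_le_mul hr ih (by positivity) (by positivity)

end LatticeSumsets

section LatticePoints

variable {d : ℕ}

theorem toReal'_injective : Function.Injective (toReal' : (Fin d → ℤ) → Fin d → ℝ) := by
  intro x y h
  funext i
  exact Int.cast_injective (α := ℝ) (congrFun h i)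

theorem toReal'_add (x y : Fin d → ℤ) : toReal' (x + y) = toReal' x + toReal' y := by
  funext i
  simp [toReal']

theorem mem_span_basisFun_iff {x : Fin d → ℝ} :
    x ∈ Submodule.span ℤ (Set.range (Pi.basisFun ℝ (Fin d))) ↔ ∃ z : Fin d → ℤ, toReal' z = x := by
  rw [Module.Basis.mem_span_iff_repr_mem]
  simp only [Pi.basisFun_repr, algebraMap_int_eq, Set.mem_range, eq_intCast]
  constructor
  · intro h
    choose z hz using h
    exact ⟨z, funext hz⟩
  · rintro ⟨z, rfl⟩ i
    exact ⟨z i, rfl⟩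

/-- Lattice points of the dilate `n • K`. -/
def latticePoints (K : Set (Fin d → ℝ)) (n : ℕ) : Set (Fin d → ℤ) :=
  {x | toReal' x ∈ (n : ℝ) • K}

theorem finite_latticePoints {K : Set (Fin d → ℝ)} (hK : Bornology.IsBounded K) (n : ℕ) :
    (latticePoints K n).Finite := by
  obtain ⟨R, hR⟩ := (hK.smul₀ (n : ℝ)).exists_norm_le
  refine (Set.finite_Icc (fun _ : Fin d => -⌈R⌉) (fun _ => ⌈R⌉)).subset fun x hx => ?_
  have h : ∀ i, |(x i : ℝ)| ≤ ⌈R⌉ := fun i =>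
    (norm_le_pi_norm (toReal' x) i).trans ((hR _ hx).trans (Int.le_ceil R))
  exact ⟨fun i => by exact_mod_cast (abs_le.1 (h i)).1, fun i => by exact_mod_cast (abs_le.1 (h i)).2⟩

theorem tendsto_ncard_latticePoints {K : Set (Fin d → ℝ)} (hK : Bornology.IsBounded K)
    (hKc : IsClosed K) (hKconv : Convex ℝ K) :
    Filter.Tendsto (fun n : ℕ => ((latticePoints K n).ncard : ℝ) / (n : ℝ) ^ d) Filter.atTop
      (nhds (volume.real K)) := by
  have h := tendsto_card_div_pow_atTop_volume K hK hKc.measurableSet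
    (hKconv.addHaar_frontier volume)
  rw [Fintype.card_fin] at h
  refine h.congr' ?_
  filter_upwards [Filter.eventually_gt_atTop 0] with n hn
  have hn' : (n : ℝ) ≠ 0 := by exact_mod_cast hn.ne'
  congr 2
  rw [Nat.card_coe_set_eq]
  have : K ∩ (n : ℝ)⁻¹ • (Submodule.span ℤ (Set.range (Pi.basisFun ℝ (Fin d))) : Set (Fin d → ℝ)) =
      (fun x : Fin d → ℤ => (n : ℝ)⁻¹ • toReal' x) '' latticePoints K n := by
    ext y
    constructor
    · rintro ⟨hy, x, hx, rfl⟩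
      obtain ⟨z, rfl⟩ := mem_span_basisFun_iff.1 hx
      exact ⟨z, (Set.mem_smul_set_iff_inv_smul_mem₀ hn' _ _).2 hy, rfl⟩
    · rintro ⟨z, hz, rfl⟩
      exact ⟨(Set.mem_smul_set_iff_inv_smul_mem₀ hn' _ _).1 hz,
        Set.smul_mem_smul_set (mem_span_basisFun_iff.2 ⟨z, rfl⟩)⟩
  rw [this]
  exact Set.ncard_image_of_injective _ fun x y hxy =>
    toReal'_injective (smul_right_injective _ (inv_ne_zero hn') hxy)

theorem iterSumset_subset_latticePoints (B : Finset (Fin d → ℤ)) (hB : B.Nonempty) (n : ℕ) :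
    (iterSumset B n : Set (Fin d → ℤ)) ⊆
      latticePoints (convexHull ℝ (toReal' '' (B : Set (Fin d → ℤ)))) n := by
  have hne : (convexHull ℝ (toReal' '' (B : Set (Fin d → ℤ)))).Nonempty :=
    convexHull_nonempty_iff.2 (Set.Nonempty.image _ hB)
  induction n with
  | zero =>
    intro x hx
    obtain rfl : x = 0 := by simpa [iterSumset] using hx
    have : toReal' (0 : Fin d → ℤ) = 0 := by funext i; simp [toReal']
    simp only [latticePoints, Set.mem_ofPred_eq, Nat.cast_zero, Set.zero_smul_set hne, this]
    exact rfl
  | succ n ih =>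
    intro x hx
    obtain ⟨y, hy, b, hb, rfl⟩ := Finset.mem_add.1 (Finset.mem_coe.1 hx)
    simp only [latticePoints, Set.mem_ofPred_eq, Nat.cast_add, Nat.cast_one, toReal'_add]
    rw [(convex_convexHull ℝ _).add_smul n.cast_nonneg zero_le_one, one_smul]
    exact Set.add_mem_add (ih hy) (subset_convexHull ℝ _ ⟨b, hb, rfl⟩)

theorem exists_latticePoints_ncard_le {k : ℕ} {u : Fin k → (Fin d → ℤ)}
    {B : Finset (Fin d → ℤ)} (h0 : (0 : Fin d → ℤ) ∈ B) (huB : ∀ i, u i ∈ B)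
    (hgen : AddSubgroup.closure (Set.range u) = ⊤) :
    ∃ c : ℕ, ∀ n : ℕ,
      (latticePoints (convexHull ℝ (toReal' '' (B : Set (Fin d → ℤ)))) n).ncard ≤
        (iterSumset B (n + c)).card := by
  classical
  let R : Fin d → ℤ := fun i => ∑ b ∈ B, |b i|
  obtain ⟨c, p, hc⟩ := exists_translate_subset_iterSumset h0 huB hgen
    (Fintype.piFinset fun i => Finset.Icc (-R i) (R i))
  refine ⟨c, fun n => ?_⟩
  have key : ∀ x ∈ latticePoints (convexHull ℝ (toReal' '' (B : Set (Fin d → ℤ)))) n,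
      x + p ∈ iterSumset B (n + c) := by
    rintro x ⟨y, hy, hxy⟩
    rw [← Finset.coe_image, Finset.mem_convexHull'] at hy
    obtain ⟨w, hw0, hw1, hwy⟩ := hy
    rw [Finset.sum_image toReal'_injective.injOn] at hw1 hwy
    have hw0' : ∀ b ∈ B, 0 ≤ (n : ℝ) * w (toReal' b) := fun b hb =>
      mul_nonneg n.cast_nonneg (hw0 _ (Finset.mem_image_of_mem _ hb))
    let a : (Fin d → ℤ) → ℕ := fun b => ⌊(n : ℝ) * w (toReal' b)⌋₊
    have ha1 : ∀ b ∈ B, (a b : ℝ) ≤ n * w (toReal' b) := fun b hb => Nat.floor_le (hw0' b hb)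
    have ha2 : ∀ b, (n : ℝ) * w (toReal' b) < a b + 1 := fun b => Nat.lt_floor_add_one _
    have hsum : ∑ b ∈ B, a b ≤ n := by
      have : ((∑ b ∈ B, a b : ℕ) : ℝ) ≤ n := by
        push_cast
        calc ∑ b ∈ B, (a b : ℝ) ≤ ∑ b ∈ B, n * w (toReal' b) := Finset.sum_le_sum ha1
          _ = n := by rw [← Finset.mul_sum, hw1, mul_one]
      exact_mod_cast this
    have hmem : ∑ b ∈ B, a b • b ∈ iterSumset B n := by
      have := sum_nsmul_mem_iterSumset (B := B) (v := fun b : B => (b : Fin d → ℤ))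
        (fun b => b.2) Finset.univ fun b => a b
      rw [Finset.sum_coe_sort B fun b => a b • b, Finset.sum_coe_sort B a] at this
      exact iterSumset_mono h0 hsum this
    have hrest : x - ∑ b ∈ B, a b • b ∈ Fintype.piFinset fun i => Finset.Icc (-R i) (R i) := by
      refine Fintype.mem_piFinset.2 fun i => ?_
      rw [Finset.mem_Icc, ← abs_le]
      have hxi : (x i : ℝ) = ∑ b ∈ B, n * w (toReal' b) * b i := by
        have h1 : (n : ℝ) • y = toReal' x := hxy
        have h2 : (x i : ℝ) = n * y i := (congrFun h1 i).symm
        rw [h2, ← hwy, Finset.sum_apply, Finset.mul_sum]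
        refine Finset.sum_congr rfl fun b _ => ?_
        simp [toReal', mul_assoc]
      have : (|(x - ∑ b ∈ B, a b • b) i| : ℝ) ≤ R i := by
        simp only [Pi.sub_apply, Finset.sum_apply, Pi.smul_apply, R]
        push_cast
        rw [hxi, ← Finset.sum_sub_distrib]
        refine (Finset.abs_sum_le_sum_abs _ _).trans (Finset.sum_le_sum fun b hb => ?_)
        rw [nsmul_eq_mul, Int.cast_mul, Int.cast_natCast, ← sub_mul, abs_mul]
        refine mul_le_of_le_one_left (abs_nonneg _) ?_
        rw [abs_le]
        constructor <;> linarith [ha1 b hb, ha2 b]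
      exact_mod_cast this
    have := Finset.add_mem_add hmem (hc _ hrest)
    rw [← iterSumset_add] at this
    convert this using 1
    abel
  rw [← Set.ncard_coe_finset]
  refine Set.ncard_le_ncard_of_injOn (· + p) key (add_left_injective p).injOn
    (Finset.finite_toSet _)

/-- The number of points of the `n`-fold sumset grows like `vol(conv B) n^d`. -/
theorem tendsto_card_iterSumset {k : ℕ} {u : Fin k → (Fin d → ℤ)}
    {B : Finset (Fin d → ℤ)} (h0 : (0 : Fin d → ℤ) ∈ B) (huB : ∀ i, u i ∈ B)
    (hgen : AddSubgroup.closure (Set.range u) = ⊤) :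
    Filter.Tendsto (fun n : ℕ => ((iterSumset B n).card : ℝ) / (n : ℝ) ^ d) Filter.atTop
      (nhds (volume.real (convexHull ℝ (toReal' '' (B : Set (Fin d → ℤ)))))) := by
  set K := convexHull ℝ (toReal' '' (B : Set (Fin d → ℤ))) with hK
  have hfin : (toReal' '' (B : Set (Fin d → ℤ))).Finite := B.finite_toSet.image _
  have hcomp : IsCompact K := hfin.isCompact_convexHull ℝ
  have hlim := tendsto_ncard_latticePoints hcomp.isBounded hcomp.isClosed (convex_convexHull ℝ _)
  obtain ⟨c, hc⟩ := exists_latticePoints_ncard_le h0 huB hgen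
  have hratio : Filter.Tendsto (fun n : ℕ => ((n : ℝ) / ((n + c : ℕ) : ℝ)) ^ d) Filter.atTop
      (nhds 1) := by
    have := (tendsto_natCast_div_add_atTop (𝕜 := ℝ) (c : ℝ)).pow d
    simpa using this
  have hlow := hlim.mul hratio
  rw [mul_one] at hlow
  have hlow' : Filter.Tendsto (fun n : ℕ => ((latticePoints K (n - c)).ncard : ℝ) / (n : ℝ) ^ d)
      Filter.atTop (nhds (volume.real K)) := by
    refine (hlow.comp (Filter.tendsto_sub_atTop_nat c)).congr' ?_
    filter_upwards [Filter.eventually_gt_atTop c] with n hn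
    have h1 : ((n - c : ℕ) : ℝ) ≠ 0 := by
      have : n - c ≠ 0 := by omega
      exact_mod_cast this
    simp only [Function.comp_apply, Nat.sub_add_cancel hn.le, div_pow]
    field_simp
  refine tendsto_of_tendsto_of_tendsto_of_le_of_le' hlow' hlim ?_ ?_
  · filter_upwards [Filter.eventually_ge_atTop c] with n hn
    have := hc (n - c)
    rw [Nat.sub_add_cancel hn] at this
    gcongr
  · refine Filter.Eventually.of_forall fun n => ?_
    gcongr
    rw [← Set.ncard_coe_finset]
    exact Set.ncard_le_ncard (iterSumset_subset_latticePoints B ⟨0, h0⟩ n)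
      (finite_latticePoints hcomp.isBounded n)

end LatticePoints

section VertexBoundary

variable {d : ℕ}

theorem tendsto_card_iterSumset_rpow (hd : 1 ≤ d) {B : Finset (Fin d → ℤ)} {v : ℝ}
    (hlim : Filter.Tendsto (fun n : ℕ => ((iterSumset B n).card : ℝ) / (n : ℝ) ^ d) Filter.atTop
      (nhds v)) :
    Filter.Tendsto (fun n : ℕ => ((iterSumset B n).card : ℝ) ^ ((1 : ℝ) / d) / n) Filter.atTop
      (nhds (v ^ ((1 : ℝ) / d))) := by
  have h := hlim.rpow_const (p := (1 : ℝ) / d) (Or.inr (by positivity))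
  refine h.congr fun n => ?_
  rw [Real.div_rpow (by positivity) (by positivity), one_div (d : ℝ),
    Real.pow_rpow_inv_natCast n.cast_nonneg (by omega)]

/-- The volume of the convex hull of a generating set is positive. -/
theorem volume_pos_of_tendsto (hd : 1 ≤ d) {B : Finset (Fin d → ℤ)} {c : ℕ} {p : Fin d → ℤ}
    (hB : B.Nonempty) (hc : ∀ x ∈ cubeVertices d, x + p ∈ iterSumset B c) {v : ℝ}
    (hlim : Filter.Tendsto (fun n : ℕ => ((iterSumset B n).card : ℝ) / (n : ℝ) ^ d) Filter.atTop
      (nhds v)) : 0 < v := by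
  have hv0 : 0 ≤ v := ge_of_tendsto' hlim fun n => by positivity
  have hroot := tendsto_card_iterSumset_rpow hd hlim
  have hgrow : ∀ m : ℕ,
      (m : ℝ) ≤ ((iterSumset B (m * (1 + c))).card : ℝ) ^ ((1 : ℝ) / d) := by
    intro m
    induction m with
    | zero => rw [Nat.cast_zero]; positivity
    | succ m ih =>
      have h := card_rpow_add_card_iterSumset_rpow_le hd hB hc
        (iterSumset_nonempty hB (m * (1 + c))) 1
      rw [← iterSumset_add] at h
      have h1 : (1 : ℝ) ≤ ((iterSumset B 1).card : ℝ) ^ ((1 : ℝ) / d) :=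
        Real.one_le_rpow (by exact_mod_cast (iterSumset_nonempty hB 1).card_pos) (by positivity)
      rw [Nat.succ_mul]
      push_cast
      linarith
  have hsub : Filter.Tendsto (fun m : ℕ => m * (1 + c)) Filter.atTop Filter.atTop :=
    Filter.tendsto_id.atTop_mul_const' (by omega)
  have hge : (1 : ℝ) / (1 + c) ≤ v ^ ((1 : ℝ) / d) := by
    refine ge_of_tendsto (hroot.comp hsub) ?_
    filter_upwards [Filter.eventually_gt_atTop 0] with m hm
    have hm' : (0 : ℝ) < m := by exact_mod_cast hm
    simp only [Function.comp_apply]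
    rw [le_div_iff₀ (by positivity)]
    refine le_trans (le_of_eq ?_) (hgrow m)
    push_cast
    field_simp
  rcases hv0.eq_or_lt with h | h
  · rw [← h, Real.zero_rpow (by positivity)] at hge
    exact absurd hge (not_le.2 (by positivity))
  · exact h

theorem tendsto_natCast_rpow_one_div_atTop (hd : 1 ≤ d) :
    Filter.Tendsto (fun n : ℕ => (n : ℝ) ^ ((1 : ℝ) / d)) Filter.atTop Filter.atTop :=
  (tendsto_rpow_atTop (by positivity)).comp tendsto_natCast_atTop_atTop

theorem eventually_le_card_add_sub_card (hd : 1 ≤ d) {B : Finset (Fin d → ℤ)} {c : ℕ}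
    {p : Fin d → ℤ} (hB : B.Nonempty) (hc : ∀ x ∈ cubeVertices d, x + p ∈ iterSumset B c) {v : ℝ}
    (hlim : Filter.Tendsto (fun n : ℕ => ((iterSumset B n).card : ℝ) / (n : ℝ) ^ d) Filter.atTop
      (nhds v)) {δ : ℝ} (hδ : 0 < δ) :
    ∀ᶠ n : ℕ in Filter.atTop, ∀ S : Finset (Fin d → ℤ), S.card = n →
      (1 - δ) * d * v ^ ((1 : ℝ) / d) * (n : ℝ) ^ (1 - (1 : ℝ) / d) ≤
        ((S + B).card : ℝ) - S.card := by
  have hd0 : (0 : ℝ) < d := by exact_mod_cast hd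
  have hw : 0 < v ^ ((1 : ℝ) / d) := Real.rpow_pos_of_pos (volume_pos_of_tendsto hd hB hc hlim) _
  have hroot := tendsto_card_iterSumset_rpow hd hlim
  set w := v ^ ((1 : ℝ) / d)
  obtain ⟨m, hm⟩ : ∃ m : ℕ, (m + c : ℝ) * (1 - δ) * w <
      ((iterSumset B m).card : ℝ) ^ ((1 : ℝ) / d) := by
    have h1 : Filter.Tendsto (fun m : ℕ => (m + c : ℝ) * (1 - δ) * w / m) Filter.atTop
        (nhds ((1 - δ) * w)) := by
      have h2 : Filter.Tendsto (fun m : ℕ => (1 + (c : ℝ) / m) * ((1 - δ) * w)) Filter.atTop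
          (nhds ((1 + 0) * ((1 - δ) * w))) :=
        ((tendsto_const_div_atTop_nhds_zero_nat (c : ℝ)).const_add 1).mul_const _
      rw [add_zero, one_mul] at h2
      refine h2.congr' ?_
      filter_upwards [Filter.eventually_gt_atTop 0] with m hm
      have hm' : (m : ℝ) ≠ 0 := by exact_mod_cast hm.ne'
      field_simp
    have h3 : (1 - δ) * w < w := by nlinarith
    obtain ⟨m, hm, hm0⟩ := ((h1.eventually_lt hroot h3).and (Filter.eventually_gt_atTop 0)).exists
    refine ⟨m, ?_⟩
    rwa [div_lt_div_iff_of_pos_right (by exact_mod_cast hm0)] at hm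
  set b := ((iterSumset B m).card : ℝ) ^ ((1 : ℝ) / d) with hb
  have hb0 : 0 ≤ b := by positivity
  have hlog := ((Real.tendsto_mul_log_one_add_div_atTop b).comp
    (tendsto_natCast_rpow_one_div_atTop hd)).eventually_const_lt hm
  filter_upwards [hlog, Filter.eventually_gt_atTop 0] with n hn hn0 S hS
  simp only [Function.comp_apply] at hn
  by_contra! hlt
  have hn0' : (0 : ℝ) < n := by exact_mod_cast hn0
  set N := (n : ℝ) ^ ((1 : ℝ) / d) with hN
  have hN0 : 0 < N := Real.rpow_pos_of_pos hn0' _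
  have hSne : S.Nonempty := Finset.card_pos.1 (hS ▸ hn0)
  obtain ⟨S', hS'S, hS'ne, hpl⟩ := exists_card_add_iterSumset_le hSne B
  rw [hS] at hlt hpl
  have hpow : (n : ℝ) ^ (1 - (1 : ℝ) / d) = n / N := by
    rw [Real.rpow_sub hn0', Real.rpow_one]
  have hK : ((S + B).card : ℝ) / n ≤ Real.exp ((1 - δ) * d * w / N) := by
    refine le_trans ?_ (Real.add_one_le_exp _)
    rw [div_le_iff₀ hn0']
    rw [hpow] at hlt
    have : ((1 - δ) * d * w / N + 1) * n = (1 - δ) * d * w * (n / N) + n := by ring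
    linarith
  have hs0 : (0 : ℝ) < S'.card := by exact_mod_cast hS'ne.card_pos
  set s := (S'.card : ℝ) ^ ((1 : ℝ) / d) with hs
  have hs0' : 0 < s := Real.rpow_pos_of_pos hs0 _
  have hsN : s ≤ N := by
    refine Real.rpow_le_rpow hs0.le ?_ (by positivity)
    rw [← hS]
    exact_mod_cast Finset.card_le_card hS'S
  have hchain : s + b ≤ Real.exp ((m + c) * (1 - δ) * w / N) * s := by
    refine (card_rpow_add_card_iterSumset_rpow_le hd hB hc hS'ne m).trans ?_
    have h1 : ((S' + iterSumset B (m + c)).card : ℝ) ≤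
        Real.exp ((m + c) * (1 - δ) * w / N * d) * S'.card := by
      refine (hpl (m + c)).trans ?_
      refine mul_le_mul_of_nonneg_right ?_ hs0.le
      refine (pow_le_pow_left₀ (by positivity) hK _).trans_eq ?_
      rw [← Real.exp_nat_mul]
      congr 1
      push_cast
      ring
    refine (Real.rpow_le_rpow (by positivity) h1 (by positivity)).trans_eq ?_
    rw [Real.mul_rpow (Real.exp_pos _).le hs0.le, ← Real.exp_mul, mul_assoc,
      mul_one_div_cancel hd0.ne', mul_one]
  have h2 : 1 + b / N ≤ Real.exp ((m + c) * (1 - δ) * w / N) := by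
    refine le_trans ?_ ((div_le_iff₀ hs0').2 hchain)
    rw [add_div, div_self hs0'.ne']
    gcongr
  have h3 := (Real.log_le_iff_le_exp (by positivity)).2 h2
  have h4 : N * Real.log (1 + b / N) ≤ N * ((m + c) * (1 - δ) * w / N) := by gcongr
  rw [mul_div_cancel₀ _ hN0.ne'] at h4
  linarith

theorem exists_card_add_sub_card_le (hd : 1 ≤ d) (B : Finset (Fin d → ℤ)) :
    ∃ C : ℝ, 0 ≤ C ∧ ∀ r : ℕ, ∃ S : Finset (Fin d → ℤ), S.card = r ∧
      ((S + B).card : ℝ) - S.card ≤ C * (r : ℝ) ^ (1 - (1 : ℝ) / d) := by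
  obtain ⟨c, hc⟩ : ∃ c : ℕ, ∀ b ∈ B, ∀ i, -(c : ℤ) ≤ b i ∧ b i ≤ c := by
    refine ⟨∑ b ∈ B, ∑ i, (b i).natAbs, fun b hb i => ?_⟩
    have h1 : (b i).natAbs ≤ ∑ i, (b i).natAbs :=
      Finset.single_le_sum (f := fun i => (b i).natAbs) (fun _ _ => Nat.zero_le _)
        (Finset.mem_univ i)
    have h2 : ∑ i, (b i).natAbs ≤ ∑ b ∈ B, ∑ i, (b i).natAbs :=
      Finset.single_le_sum (f := fun b : Fin d → ℤ => ∑ i, (b i).natAbs)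
        (fun _ _ => Nat.zero_le _) hb
    omega
  refine ⟨(1 + 2 * c) * d * (2 + 2 * c) ^ (d - 1), by positivity, fun r => ?_⟩
  rcases Nat.eq_zero_or_pos r with rfl | hr
  · exact ⟨∅, rfl, by simp only [Finset.empty_add, Finset.card_empty, sub_self]; positivity⟩
  have hr1 : (1 : ℝ) ≤ r := by exact_mod_cast hr
  set t := (r : ℝ) ^ ((1 : ℝ) / d) with ht
  have ht1 : 1 ≤ t := Real.one_le_rpow hr1 (by positivity)
  have htd : t ^ d = r := by
    rw [ht, one_div]; exact Real.rpow_inv_natCast_pow (by positivity) (by omega)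
  set h : ℕ := ⌊t⌋₊ with hh
  have hh1 : (1 : ℝ) ≤ h := by exact_mod_cast (Nat.one_le_floor_iff _).2 ht1
  have hle : (h : ℝ) ≤ t := Nat.floor_le (by linarith)
  have hlt : t < h + 1 := Nat.lt_floor_add_one t
  let box : Finset (Fin d → ℤ) := Fintype.piFinset fun _ => Finset.Ico 0 ((h + 1 : ℕ) : ℤ)
  have hbox : r ≤ box.card := by
    have : (r : ℝ) ≤ ((h + 1) ^ d : ℕ) := by
      rw [← htd]
      push_cast
      exact pow_le_pow_left₀ (by linarith) hlt.le d
    have hcard : box.card = (h + 1) ^ d := by simp [box]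
    rw [hcard]
    exact_mod_cast this
  obtain ⟨S, hS, hSr⟩ := Finset.exists_subset_card_eq hbox
  refine ⟨S, hSr, ?_⟩
  have hsub : S + B ⊆ Fintype.piFinset fun _ => Finset.Ico (-(c : ℤ)) (h + 1 + c : ℕ) := by
    intro x hx
    obtain ⟨s, hs, b, hb, rfl⟩ := Finset.mem_add.1 hx
    refine Fintype.mem_piFinset.2 fun i => Finset.mem_Ico.2 ?_
    have h1 := Finset.mem_Ico.1 (Fintype.mem_piFinset.1 (hS hs) i)
    have h2 := hc b hb i
    simp only [Pi.add_apply]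
    push_cast at h1 ⊢
    omega
  have hcard : ((S + B).card : ℝ) ≤ (h + (1 + 2 * c)) ^ d := by
    have h1 := Finset.card_le_card hsub
    rw [Fintype.card_piFinset_const, Int.card_Ico] at h1
    have h2 : (((h + 1 + c : ℕ) : ℤ) - -(c : ℤ)).toNat = h + (1 + 2 * c) := by omega
    rw [h2] at h1
    exact_mod_cast h1
  have hhd : (h : ℝ) ^ d ≤ S.card := by
    rw [hSr, ← htd]
    exact pow_le_pow_left₀ (by positivity) hle d
  have hdiff : ((h : ℝ) + (1 + 2 * c)) ^ d - (h : ℝ) ^ d ≤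
      (1 + 2 * c) * d * (h + (1 + 2 * c)) ^ (d - 1) := by
    have h1 := abs_pow_sub_pow_le ((h : ℝ) + (1 + 2 * c)) h d
    rw [add_sub_cancel_left, abs_of_nonneg (by positivity : (0 : ℝ) ≤ 1 + 2 * c),
      abs_of_nonneg (by positivity : (0 : ℝ) ≤ h + (1 + 2 * c)),
      abs_of_nonneg (by positivity : (0 : ℝ) ≤ h),
      max_eq_left (by linarith [c.cast_nonneg (α := ℝ)])] at h1
    exact (le_abs_self _).trans h1
  have hpow : (r : ℝ) ^ (1 - (1 : ℝ) / d) = t ^ (d - 1) := by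
    rw [ht, ← Real.rpow_natCast, ← Real.rpow_mul (by positivity), Nat.cast_sub hd]
    congr 1
    have : (d : ℝ) ≠ 0 := by positivity
    field_simp
    simp
  have hmono : ((h : ℝ) + (1 + 2 * c)) ^ (d - 1) ≤ ((2 + 2 * c) * t) ^ (d - 1) := by
    refine pow_le_pow_left₀ (by positivity) ?_ _
    have : (0 : ℝ) ≤ c := c.cast_nonneg
    nlinarith
  rw [hpow]
  calc ((S + B).card : ℝ) - S.card ≤ (1 + 2 * c) * d * (h + (1 + 2 * c)) ^ (d - 1) := by linarith
    _ ≤ (1 + 2 * c) * d * ((2 + 2 * c) * t) ^ (d - 1) := by gcongr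
    _ = (1 + 2 * c) * d * (2 + 2 * c) ^ (d - 1) * t ^ (d - 1) := by rw [mul_pow]; ring

end VertexBoundary

section UpperBound

variable {d : ℕ}

theorem tendsto_card_iterSumset_floor {B : Finset (Fin d → ℤ)} {v : ℝ}
    (hlim : Filter.Tendsto (fun n : ℕ => ((iterSumset B n).card : ℝ) / (n : ℝ) ^ d) Filter.atTop
      (nhds v)) {c : ℝ} (hc : 0 < c) :
    Filter.Tendsto (fun T : ℝ => ((iterSumset B ⌊c * T⌋₊).card : ℝ) / T ^ d) Filter.atTop
      (nhds (v * c ^ d)) := by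
  have hfloor : Filter.Tendsto (fun T : ℝ => ⌊c * T⌋₊) Filter.atTop Filter.atTop :=
    tendsto_nat_floor_atTop.comp (Filter.tendsto_id.const_mul_atTop hc)
  have h := (hlim.comp hfloor).mul ((tendsto_nat_floor_mul_div_atTop hc.le).pow d)
  refine h.congr' ?_
  filter_upwards [hfloor.eventually_gt_atTop 0] with T hT
  have hT' : ((⌊c * T⌋₊ : ℕ) : ℝ) ≠ 0 := by exact_mod_cast hT.ne'
  simp only [Function.comp_apply]
  rw [div_pow, div_mul_div_cancel₀ (pow_ne_zero _ hT')]

theorem eventually_exists_iterSumset_real (hd : 1 ≤ d) {B : Finset (Fin d → ℤ)}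
    (h0 : (0 : Fin d → ℤ) ∈ B) {v : ℝ} (hv : 0 < v)
    (hlim : Filter.Tendsto (fun n : ℕ => ((iterSumset B n).card : ℝ) / (n : ℝ) ^ d) Filter.atTop
      (nhds v)) {ρ η : ℝ} (hρ : 0 < ρ) (hρ1 : ρ < 1) (hη : 0 < η) :
    ∀ᶠ T : ℝ in Filter.atTop, ∃ k : ℕ, ((iterSumset B k).card : ℝ) ≤ v * T ^ d ∧
      v * T ^ d - (iterSumset B k).card ≤ ρ * (v * T ^ d) ∧
      ((iterSumset B (k + 1)).card : ℝ) - (iterSumset B k).card ≤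
        (1 + η) * d * (v * T ^ (d - 1)) := by
  have hd0 : (1 : ℝ) ≤ d := by exact_mod_cast hd
  set a : ℕ → ℝ := fun m => ((iterSumset B m).card : ℝ) with ha
  have ha_mono : Monotone a := fun i j hij => by
    simp only [ha]
    exact_mod_cast Finset.card_le_card (iterSumset_mono h0 hij)
  obtain ⟨ε, hε⟩ : ∃ ε : ℝ, ε = ρ / (4 * d) := ⟨_, rfl⟩
  have hεd : 4 * d * ε = ρ := by rw [hε]; field_simp
  have hε0 : 0 < ε := by rw [hε]; positivity
  have hε1 : ε < 1 / 4 := by nlinarith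
  have hJ := tendsto_card_iterSumset_floor hlim (c := 1 - ε) (by linarith)
  have hI := tendsto_card_iterSumset_floor hlim (c := 1 - 2 * ε) (by linarith)
  have hlen := (tendsto_nat_floor_mul_div_atTop (R := ℝ) (a := 1 - ε) (by linarith)).sub
    (tendsto_nat_floor_mul_div_atTop (R := ℝ) (a := 1 - 2 * ε) (by linarith))
  have hslope : v * (1 - ε) ^ d - v * (1 - 2 * ε) ^ d <
      (1 + η) * d * v * ((1 - ε) - (1 - 2 * ε)) := by
    have h1 := abs_pow_sub_pow_le (1 - ε) (1 - 2 * ε) d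
    have h2 : (1 - ε) - (1 - 2 * ε) = ε := by ring
    rw [h2, abs_of_pos hε0, abs_of_pos (by linarith : 0 < 1 - ε),
      abs_of_pos (by linarith : 0 < 1 - 2 * ε), max_eq_left (by linarith)] at h1
    have h3 : (1 - ε) ^ (d - 1) ≤ 1 := pow_le_one₀ (by linarith) (by linarith)
    have h4 : (1 - ε) ^ d - (1 - 2 * ε) ^ d ≤ ε * d := by
      refine (le_abs_self _).trans (h1.trans ?_)
      exact mul_le_of_le_one_right (by positivity) h3
    rw [h2]
    have h5 : v * ((1 - ε) ^ d - (1 - 2 * ε) ^ d) ≤ v * (ε * d) := by gcongr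
    have h6 : 0 < η * (d * v * ε) := by positivity
    linarith
  have hupper : v * (1 - ε) ^ d < v := by
    have h1 : (1 - ε) ^ d < 1 := pow_lt_one₀ (by linarith) (by linarith) (by omega)
    nlinarith
  have hlower : v * (1 - ρ) < v * (1 - 2 * ε) ^ d := by
    have h1 := one_add_mul_le_pow (a := -(2 * ε)) (by linarith) d
    rw [← sub_eq_add_neg] at h1
    have h2 : 1 - ρ < (1 - 2 * ε) ^ d := by linarith
    gcongr
  filter_upwards [(hJ.sub hI).eventually_lt (hlen.const_mul ((1 + η) * d * v)) hslope,
    hJ.eventually_lt_const hupper, hI.eventually_const_lt hlower,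
    Filter.eventually_gt_atTop 0] with T hT hTJ hTI hT0
  have hTd : 0 < T ^ d := pow_pos hT0 d
  set J := ⌊(1 - ε) * T⌋₊
  set I := ⌊(1 - 2 * ε) * T⌋₊
  have hIJ : I ≤ J := Nat.floor_mono (by nlinarith)
  rw [div_lt_iff₀ hTd] at hTJ
  rw [lt_div_iff₀ hTd] at hTI
  have hTsucc : T ^ d = T * T ^ (d - 1) := by rw [← pow_succ', Nat.sub_add_cancel hd]
  have hgap : a J - a I < (1 + η) * d * (v * T ^ (d - 1)) * (J - I) := by
    rw [← sub_div, ← sub_div, div_lt_iff₀ hTd, hTsucc] at hT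
    refine hT.trans_eq ?_
    field_simp
  obtain ⟨i, hi, hstep⟩ : ∃ i < J - I,
      a (I + i + 1) - a (I + i) ≤ (1 + η) * d * (v * T ^ (d - 1)) := by
    by_contra! hcon
    have hsum := Finset.sum_range_sub (fun i => a (I + i)) (J - I)
    have hle : ∑ _i ∈ Finset.range (J - I), (1 + η) * d * (v * T ^ (d - 1)) ≤
        ∑ i ∈ Finset.range (J - I), (a (I + (i + 1)) - a (I + i)) :=
      Finset.sum_le_sum fun i hi => (hcon i (Finset.mem_range.1 hi)).le
    rw [hsum, Finset.sum_const, Finset.card_range, nsmul_eq_mul, Nat.cast_sub hIJ,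
      Nat.add_sub_cancel' hIJ, add_zero] at hle
    linarith
  refine ⟨I + i, ?_, ?_, hstep⟩
  · exact (ha_mono (by omega : I + i ≤ J)).trans hTJ.le
  · have h1 : a I ≤ a (I + i) := ha_mono (by omega)
    simp only [ha] at h1
    linarith

theorem eventually_exists_iterSumset (hd : 1 ≤ d) {B : Finset (Fin d → ℤ)}
    (h0 : (0 : Fin d → ℤ) ∈ B) {v : ℝ} (hv : 0 < v)
    (hlim : Filter.Tendsto (fun n : ℕ => ((iterSumset B n).card : ℝ) / (n : ℝ) ^ d) Filter.atTop
      (nhds v)) {ρ η : ℝ} (hρ : 0 < ρ) (hρ1 : ρ < 1) (hη : 0 < η) :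
    ∀ᶠ n : ℕ in Filter.atTop, ∃ k : ℕ, (iterSumset B k).card ≤ n ∧
      (n : ℝ) - (iterSumset B k).card ≤ ρ * n ∧
      ((iterSumset B (k + 1)).card : ℝ) - (iterSumset B k).card ≤
        (1 + η) * d * v ^ ((1 : ℝ) / d) * (n : ℝ) ^ (1 - (1 : ℝ) / d) := by
  have hd0 : (0 : ℝ) < d := by exact_mod_cast hd
  have hw : 0 < v ^ ((1 : ℝ) / d) := Real.rpow_pos_of_pos hv _
  have hT := (tendsto_natCast_rpow_one_div_atTop hd).atTop_div_const hw
  filter_upwards [hT.eventually (eventually_exists_iterSumset_real hd h0 hv hlim hρ hρ1 hη),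
    Filter.eventually_gt_atTop 0] with n hn hn0
  have hn0' : (0 : ℝ) < n := by exact_mod_cast hn0
  have hroot : ∀ x : ℝ, 0 ≤ x → (x ^ ((1 : ℝ) / d)) ^ d = x := fun x hx => by
    rw [one_div]; exact Real.rpow_inv_natCast_pow hx (by omega)
  have h1 : v * ((n : ℝ) ^ ((1 : ℝ) / d) / v ^ ((1 : ℝ) / d)) ^ d = n := by
    rw [div_pow, hroot _ hn0'.le, hroot _ hv.le]
    field_simp
  have h2 : v * ((n : ℝ) ^ ((1 : ℝ) / d) / v ^ ((1 : ℝ) / d)) ^ (d - 1) =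
      v ^ ((1 : ℝ) / d) * (n : ℝ) ^ (1 - (1 : ℝ) / d) := by
    have hN : 0 < (n : ℝ) ^ ((1 : ℝ) / d) := Real.rpow_pos_of_pos hn0' _
    rw [pow_sub₀ _ (by positivity) hd, ← mul_assoc, h1, Real.rpow_sub hn0', Real.rpow_one]
    field_simp
  rw [h1, h2, ← mul_assoc] at hn
  obtain ⟨k, hk1, hk2, hk3⟩ := hn
  exact ⟨k, by exact_mod_cast hk1, hk2, hk3⟩

theorem card_union_add_sub_card_le {S R : Finset (Fin d → ℤ)} (hSR : Disjoint S R)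
    (B : Finset (Fin d → ℤ)) :
    (((S ∪ R) + B).card : ℝ) - (S ∪ R).card ≤
      (((S + B).card : ℝ) - S.card) + (((R + B).card : ℝ) - R.card) := by
  rw [Finset.union_add, Finset.card_union_of_disjoint hSR]
  have h : ((S + B ∪ (R + B)).card : ℝ) ≤ (S + B).card + (R + B).card := by
    exact_mod_cast Finset.card_union_le _ _
  push_cast
  linarith

theorem exists_disjoint_translate (hd : 1 ≤ d) (S R : Finset (Fin d → ℤ)) :
    ∃ t : Fin d → ℤ, Disjoint S (R + {t}) := by
  have : Nonempty (Fin d) := ⟨⟨0, hd⟩⟩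
  obtain ⟨t, ht⟩ := Infinite.exists_notMem_finset (S - R)
  refine ⟨t, Finset.disjoint_left.2 fun x hxS hxR => ht ?_⟩
  obtain ⟨r, hr, s, hs, rfl⟩ := Finset.mem_add.1 hxR
  rw [Finset.mem_singleton.1 hs] at hxS
  exact Finset.mem_sub.2 ⟨_, hxS, r, hr, add_sub_cancel_left r t⟩

theorem eventually_exists_card_add_sub_card_le (hd : 2 ≤ d) {B : Finset (Fin d → ℤ)}
    (h0 : (0 : Fin d → ℤ) ∈ B) {v : ℝ} (hv : 0 < v)
    (hlim : Filter.Tendsto (fun n : ℕ => ((iterSumset B n).card : ℝ) / (n : ℝ) ^ d) Filter.atTop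
      (nhds v)) {δ : ℝ} (hδ : 0 < δ) :
    ∀ᶠ n : ℕ in Filter.atTop, ∃ S : Finset (Fin d → ℤ), S.card = n ∧
      ((S + B).card : ℝ) - S.card ≤
        (1 + δ) * d * v ^ ((1 : ℝ) / d) * (n : ℝ) ^ (1 - (1 : ℝ) / d) := by
  have hd1 : 1 ≤ d := by omega
  have hd0 : (2 : ℝ) ≤ d := by exact_mod_cast hd
  have hw : 0 < v ^ ((1 : ℝ) / d) := Real.rpow_pos_of_pos hv _
  have he : 0 < 1 - (1 : ℝ) / d := by
    rw [sub_pos, div_lt_one (by linarith)]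
    linarith
  obtain ⟨C, hC0, hC⟩ := exists_card_add_sub_card_le hd1 B
  obtain ⟨ρ, hρC, hρ0, hρ1⟩ : ∃ ρ : ℝ,
      C * ρ ^ (1 - (1 : ℝ) / d) < δ / 2 * d * v ^ ((1 : ℝ) / d) ∧ 0 < ρ ∧ ρ < 1 := by
    have hcont : Filter.Tendsto (fun ρ : ℝ => C * ρ ^ (1 - (1 : ℝ) / d))
        (nhdsWithin 0 (Set.Ioi 0)) (nhds 0) := by
      have h := ((Real.continuous_rpow_const he.le).const_mul C).tendsto 0
      simp only [Real.zero_rpow he.ne', mul_zero] at h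
      exact h.mono_left nhdsWithin_le_nhds
    exact ((hcont.eventually_lt_const (by positivity)).and
      (Ioo_mem_nhdsGT (zero_lt_one' ℝ))).exists
  filter_upwards [eventually_exists_iterSumset hd1 h0 hv hlim hρ0 hρ1 (half_pos hδ)] with n hn
  obtain ⟨k, hkn, hrem, hstep⟩ := hn
  obtain ⟨R, hRcard, hR⟩ := hC (n - (iterSumset B k).card)
  obtain ⟨t, ht⟩ := exists_disjoint_translate hd1 (iterSumset B k) R
  have hRt : (R + {t}).card = R.card := Finset.card_add_singleton R t
  have hRtB : (R + {t} + B).card = (R + B).card := by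
    rw [add_right_comm, Finset.card_add_singleton]
  refine ⟨iterSumset B k ∪ (R + {t}), ?_, ?_⟩
  · rw [Finset.card_union_of_disjoint ht, hRt, hRcard]
    omega
  · refine (card_union_add_sub_card_le ht B).trans ?_
    rw [hRt, hRtB]
    have hsucc : iterSumset B k + B = iterSumset B (k + 1) := rfl
    rw [hsucc]
    have hR' : C * ((n - (iterSumset B k).card : ℕ) : ℝ) ^ (1 - (1 : ℝ) / d) ≤
        δ / 2 * d * v ^ ((1 : ℝ) / d) * (n : ℝ) ^ (1 - (1 : ℝ) / d) := by
      rw [Nat.cast_sub hkn]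
      have h1 : ((n : ℝ) - (iterSumset B k).card) ^ (1 - (1 : ℝ) / d) ≤
          ρ ^ (1 - (1 : ℝ) / d) * (n : ℝ) ^ (1 - (1 : ℝ) / d) := by
        rw [← Real.mul_rpow hρ0.le n.cast_nonneg]
        refine Real.rpow_le_rpow ?_ hrem he.le
        rw [sub_nonneg]
        exact_mod_cast hkn
      calc _ ≤ C * (ρ ^ (1 - (1 : ℝ) / d) * (n : ℝ) ^ (1 - (1 : ℝ) / d)) := by gcongr
        _ = C * ρ ^ (1 - (1 : ℝ) / d) * (n : ℝ) ^ (1 - (1 : ℝ) / d) := by ring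
        _ ≤ _ := by gcongr
    linarith

/-- In dimension one, intervals have vertex boundary at most the length of the convex hull. -/
theorem exists_card_add_sub_card_le_of_dim_one {B : Finset (Fin 1 → ℤ)} (hB : B.Nonempty)
    (n : ℕ) :
    ∃ S : Finset (Fin 1 → ℤ), S.card = n ∧ ((S + B).card : ℝ) - S.card ≤
      volume.real (convexHull ℝ (toReal' '' (B : Set (Fin 1 → ℤ)))) := by
  obtain ⟨x, hx, hxmin⟩ := B.exists_min_image (fun b => b 0) hB
  obtain ⟨y, hy, hymax⟩ := B.exists_max_image (fun b => b 0) hB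
  have hxy : x 0 ≤ y 0 := hxmin y hy
  have hvol : ((y 0 : ℝ) - x 0) ≤
      volume.real (convexHull ℝ (toReal' '' (B : Set (Fin 1 → ℤ)))) := by
    have hbox : volume.real (Set.Icc (toReal' x) (toReal' y)) = (y 0 : ℝ) - x 0 := by
      have hle : toReal' x ≤ toReal' y := fun i => by
        rw [Subsingleton.elim i 0]
        simpa [toReal'] using hxy
      rw [measureReal_def, Real.volume_Icc_pi_toReal hle]
      simp [toReal']
    rw [← hbox]
    refine measureReal_mono ?_ ?_
    · intro f hf
      have hf0 : f 0 ∈ segment ℝ (x 0 : ℝ) (y 0) := by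
        rw [segment_eq_Icc (by exact_mod_cast hxy)]
        exact ⟨hf.1 0, hf.2 0⟩
      obtain ⟨a, b, ha, hb, hab, hf0⟩ := hf0
      have hfab : f = a • toReal' x + b • toReal' y := by
        ext i
        rw [Subsingleton.elim i 0, ← hf0]
        simp [toReal']
      rw [hfab]
      exact convex_convexHull ℝ _ (subset_convexHull ℝ _ (Set.mem_image_of_mem _ hx))
        (subset_convexHull ℝ _ (Set.mem_image_of_mem _ hy)) ha hb hab
    · exact (Set.Finite.isCompact_convexHull ℝ (B.finite_toSet.image _)).measure_lt_top.ne
  refine ⟨Fintype.piFinset fun _ => Finset.Ico 0 (n : ℤ), by simp, ?_⟩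
  rcases Nat.eq_zero_or_pos n with rfl | hn
  · have hempty : (Fintype.piFinset fun _ : Fin 1 => Finset.Ico (0 : ℤ) ((0 : ℕ) : ℤ)) = ∅ := by
      rw [← Finset.card_eq_zero]
      simp
    rw [hempty, Finset.empty_add]
    simp
  have hsub : (Fintype.piFinset fun _ : Fin 1 => Finset.Ico (0 : ℤ) n) + B ⊆
      Fintype.piFinset fun _ => Finset.Ico (x 0) (n + y 0) := by
    intro z hz
    obtain ⟨s, hs, b, hb, rfl⟩ := Finset.mem_add.1 hz
    refine Fintype.mem_piFinset.2 fun i => Finset.mem_Ico.2 ?_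
    have h1 := Finset.mem_Ico.1 (Fintype.mem_piFinset.1 hs i)
    have h2 := hxmin b hb
    have h3 := hymax b hb
    rw [Subsingleton.elim i 0] at h1 ⊢
    simp only [Pi.add_apply]
    omega
  have h1 := Finset.card_le_card hsub
  rw [Fintype.card_piFinset_const, Int.card_Ico, pow_one] at h1
  have h2 : (((Fintype.piFinset fun _ : Fin 1 => Finset.Ico (0 : ℤ) n) + B).card : ℤ) ≤
      n + y 0 - x 0 := by omega
  have h3 : (((Fintype.piFinset fun _ : Fin 1 => Finset.Ico (0 : ℤ) n) + B).card : ℝ) ≤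
      n + y 0 - x 0 := by exact_mod_cast h2
  have h4 : ((Fintype.piFinset fun _ : Fin 1 => Finset.Ico (0 : ℤ) n).card : ℝ) = n := by simp
  rw [h4]
  linarith

end UpperBound

theorem vertex_isoperimetry (d k : ℕ) (hd : 1 ≤ d)
    (u : Fin k → (Fin d → ℤ)) (hu : ∀ i, u i ≠ 0)
    (hgen : AddSubgroup.closure (Set.range u) = ⊤)
    (U : Set (Fin d → ℝ))
    (hU : U = convexHull ℝ (toReal' '' (Set.range u ∪ {0})))
    (δ : ℝ) (hδ : 0 < δ) :
    ∃ n₀ : ℕ, ∀ n : ℕ, n₀ ≤ n →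
      (∀ S : Finset (Fin d → ℤ), S.card = n →
        (1 - δ) * d * (volume U).toReal ^ ((1 : ℝ) / d) * (n : ℝ) ^ (1 - (1 : ℝ) / d)
          ≤ vertexBdry u S) ∧
      (∃ S : Finset (Fin d → ℤ), S.card = n ∧
        vertexBdry u S
          ≤ (1 + δ) * d * (volume U).toReal ^ ((1 : ℝ) / d) * (n : ℝ) ^ (1 - (1 : ℝ) / d)) := by
  unfold vertexBdry
  set B : Finset (Fin d → ℤ) := insert 0 (Finset.univ.image u) with hBdef
  have h0 : (0 : Fin d → ℤ) ∈ B := Finset.mem_insert_self _ _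
  have huB : ∀ i, u i ∈ B := fun i =>
    Finset.mem_insert_of_mem (Finset.mem_image_of_mem u (Finset.mem_univ i))
  have hBU : (volume U).toReal = volume.real (convexHull ℝ (toReal' '' (B : Set (Fin d → ℤ)))) := by
    have hcoe : (B : Set (Fin d → ℤ)) = Set.range u ∪ {0} := by
      simp [hBdef]
    rw [hU, hcoe, measureReal_def]
  rw [hBU]
  have hlim := tendsto_card_iterSumset h0 huB hgen
  obtain ⟨c, p, hc⟩ := exists_translate_subset_iterSumset h0 huB hgen (cubeVertices d)
  have hv := volume_pos_of_tendsto hd ⟨0, h0⟩ hc hlim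
  have hlow := eventually_le_card_add_sub_card hd ⟨0, h0⟩ hc hlim hδ
  have hupp : ∀ᶠ n : ℕ in Filter.atTop, ∃ S : Finset (Fin d → ℤ), S.card = n ∧
      ((S + B).card : ℝ) - S.card ≤
        (1 + δ) * d * volume.real (convexHull ℝ (toReal' '' (B : Set (Fin d → ℤ)))) ^
          ((1 : ℝ) / d) * (n : ℝ) ^ (1 - (1 : ℝ) / d) := by
    rcases hd.eq_or_lt with rfl | hd2
    · refine Filter.Eventually.of_forall fun n => ?_
      obtain ⟨S, hS, hSB⟩ := exists_card_add_sub_card_le_of_dim_one ⟨0, h0⟩ n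
      refine ⟨S, hS, hSB.trans ?_⟩
      norm_num
      nlinarith
    · exact eventually_exists_card_add_sub_card_le hd2 h0 hv hlim hδ
  exact Filter.eventually_atTop.1 (hlow.and hupp)
end

section
/- Let d ≥ 1 and let U = {u_1, …, u_k} be a finite set of non-zero vectors in ℤ^d that generate ℤ^d as a group. Then the function ∂*(n) = min{∂(S) : S ⊆ ℤ^d finite, |S| = n} is monotone increasing in n: for all n ∈ ℕ, ∂*(n) ≤ ∂*(n+1). -/
open Pointwise

/-- Edge boundary of a finite set `S ⊆ ℤ^d` in the Cayley graph generated by `u`. -/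
def edgeBdry {d k : ℕ} (u : Fin k → (Fin d → ℤ)) (S : Finset (Fin d → ℤ)) : ℕ :=
  ∑ i, (S.filter (fun v => v + u i ∉ S)).card

/-- `∂*(n)`: the minimum edge boundary over all finite `S ⊆ ℤ^d` with `|S| = n`. -/
noncomputable def edgeOpt {d k : ℕ} (u : Fin k → (Fin d → ℤ)) (n : ℕ) : ℕ :=
  sInf {m | ∃ S : Finset (Fin d → ℤ), S.card = n ∧ edgeBdry u S = m}

/-- Deleting a point `v` from `S` does not increase the boundary in direction `x`, provided at most
one of `v + x` and `v - x` lies in `S`. -/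
theorem card_bdry_erase_le {G : Type*} [AddCommGroup G] [DecidableEq G] {S : Finset G} {v x : G}
    (hv : v ∈ S) (h : v + x ∉ S ∨ v - x ∉ S) :
    ((S.erase v).filter (fun w => w + x ∉ S.erase v)).card ≤
      (S.filter (fun w => w + x ∉ S)).card := by
  rcases h with h | h
  · have hmem : v ∈ S.filter (fun w => w + x ∉ S) := Finset.mem_filter.2 ⟨hv, h⟩
    calc ((S.erase v).filter (fun w => w + x ∉ S.erase v)).card
        ≤ (insert (v - x) ((S.filter (fun w => w + x ∉ S)).erase v)).card := by
          refine Finset.card_le_card fun w hw => ?_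
          simp only [Finset.mem_filter, Finset.mem_erase, Finset.mem_insert, eq_sub_iff_add_eq]
            at hw ⊢
          tauto
      _ ≤ ((S.filter (fun w => w + x ∉ S)).erase v).card + 1 := Finset.card_insert_le _ _
      _ = _ := Finset.card_erase_add_one hmem
  · refine Finset.card_le_card fun w hw => ?_
    simp only [Finset.mem_filter, Finset.mem_erase] at hw ⊢
    refine ⟨hw.1.2, fun hS => hw.2 ⟨fun he => h ?_, hS⟩⟩
    rw [← he, add_sub_cancel_right]
    exact hw.1.2

/-- Every nonempty finite set has a point, namely its lexicographic maximum, whose deletion does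
not increase the edge boundary. -/
theorem exists_edgeBdry_erase_le {d k : ℕ} (u : Fin k → (Fin d → ℤ)) (hu : ∀ i, u i ≠ 0)
    {S : Finset (Fin d → ℤ)} (hS : S.Nonempty) :
    ∃ v ∈ S, edgeBdry u (S.erase v) ≤ edgeBdry u S := by
  obtain ⟨v, hv, hmax⟩ := S.exists_max_image (fun w => toLex w) hS
  refine ⟨v, hv, Finset.sum_le_sum fun i _ => ?_⟩
  have hne : toLex (u i) ≠ 0 := fun h => hu i (toLex.injective h)
  convert card_bdry_erase_le (x := u i) hv ?_
  rcases lt_or_gt_of_ne hne with h | h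
  · refine Or.inr fun hm => (hmax _ hm).not_gt ?_
    rw [toLex_sub]
    exact (lt_sub_comm.trans (by rw [sub_self])).2 h
  · refine Or.inl fun hm => (hmax _ hm).not_gt ?_
    rw [toLex_add]
    exact lt_add_of_pos_right _ h

theorem edgeOpt_monotone (d k : ℕ) (hd : 1 ≤ d)
    (u : Fin k → (Fin d → ℤ)) (hu : ∀ i, u i ≠ 0)
    (hgen : AddSubgroup.closure (Set.range u) = ⊤) :
    ∀ n : ℕ, edgeOpt u n ≤ edgeOpt u (n + 1) := by
  intro n
  have : Nonempty (Fin d) := ⟨⟨0, hd⟩⟩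
  have hne : {m | ∃ S : Finset (Fin d → ℤ), S.card = n + 1 ∧ edgeBdry u S = m}.Nonempty := by
    obtain ⟨S, hS⟩ := Infinite.exists_subset_card_eq (Fin d → ℤ) (n + 1)
    exact ⟨_, S, hS, rfl⟩
  obtain ⟨S, hS, hSm⟩ := Nat.sInf_mem hne
  obtain ⟨v, hv, hle⟩ := exists_edgeBdry_erase_le u hu
    (Finset.card_pos.1 (by omega : 0 < S.card))
  calc edgeOpt u n ≤ edgeBdry u (S.erase v) :=
        Nat.sInf_le ⟨S.erase v, by rw [Finset.card_erase_of_mem hv, hS]; rfl, rfl⟩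
    _ ≤ edgeBdry u S := hle
    _ = edgeOpt u (n + 1) := hSm
end

section
/- Let d ≥ 1 and let U = {u_1, …, u_k} be a finite set of non-zero vectors in ℤ^d that generate ℤ^d as a group. Then there exist constants 0 < c < C (depending only on d and U) such that for all n ≥ 1, c·n^{1−1/d} ≤ ∂*(n) ≤ C·n^{1−1/d}. -/
open Pointwise

open Finset in
theorem card_filter_add_add_le {d : ℕ} (S : Finset (Fin d → ℤ)) (w w' : Fin d → ℤ) :
    #{v ∈ S | v + (w + w') ∉ S} ≤ #{v ∈ S | v + w ∉ S} + #{v ∈ S | v + w' ∉ S} := by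
  have hsub : {v ∈ S | v + (w + w') ∉ S} ⊆
      {v ∈ S | v + w ∉ S} ∪ {v ∈ S | v + w ∈ S ∧ v + w + w' ∉ S} := by
    intro v
    simp only [mem_filter, mem_union, add_assoc]
    tauto
  refine (card_le_card hsub).trans ((card_union_le _ _).trans (Nat.add_le_add_left ?_ _))
  refine card_le_card_of_injOn (· + w) ?_ (add_left_injective w).injOn
  intro v hv
  simp only [coe_filter, Set.mem_ofPred_eq] at hv ⊢
  exact hv.2

open Finset in
theorem card_filter_add_neg_le {d : ℕ} (S : Finset (Fin d → ℤ)) (w : Fin d → ℤ) :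
    #{v ∈ S | v + -w ∉ S} ≤ #{v ∈ S | v + w ∉ S} := by
  have hle : #{v ∈ S | v + w ∈ S} ≤ #{v ∈ S | v + -w ∈ S} := by
    refine card_le_card_of_injOn (· + w) ?_ (add_left_injective w).injOn
    intro v hv
    simp only [coe_filter, Set.mem_ofPred_eq, add_neg_cancel_right] at hv ⊢
    exact hv.symm
  have h₁ := S.card_filter_add_card_filter_not (fun v => v + w ∈ S)
  have h₂ := S.card_filter_add_card_filter_not (fun v => v + -w ∈ S)
  omega

open Finset in
theorem exists_card_filter_le_mul_edgeBdry {d k : ℕ} (u : Fin k → (Fin d → ℤ))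
    {w : Fin d → ℤ} (hw : w ∈ AddSubgroup.closure (Set.range u)) :
    ∃ K : ℕ, ∀ S : Finset (Fin d → ℤ), #{v ∈ S | v + w ∉ S} ≤ K * edgeBdry u S := by
  induction hw using AddSubgroup.closure_induction with
  | mem x hx =>
    obtain ⟨i, rfl⟩ := hx
    refine ⟨1, fun S => ?_⟩
    rw [one_mul]
    exact single_le_sum (f := fun i => #{v ∈ S | v + u i ∉ S}) (fun _ _ => Nat.zero_le _)
      (mem_univ i)
  | zero => exact ⟨0, fun S => by simp⟩
  | add x y _ _ hx hy =>
    obtain ⟨K, hK⟩ := hx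
    obtain ⟨L, hL⟩ := hy
    refine ⟨K + L, fun S => ?_⟩
    rw [add_mul]
    exact (card_filter_add_add_le S x y).trans (add_le_add (hK S) (hL S))
  | neg x _ hx =>
    obtain ⟨K, hK⟩ := hx
    exact ⟨K, fun S => (card_filter_add_neg_le S x).trans (hK S)⟩

/-- The edge boundaries with respect to a generating family dominate, up to a constant, those
with respect to any other finite family. -/
theorem exists_edgeBdry_le_mul_edgeBdry {d k l : ℕ} {u : Fin k → (Fin d → ℤ)}
    (hu : AddSubgroup.closure (Set.range u) = ⊤) (v : Fin l → (Fin d → ℤ)) :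
    ∃ K : ℕ, ∀ S : Finset (Fin d → ℤ), edgeBdry v S ≤ K * edgeBdry u S := by
  choose K hK using fun i => exists_card_filter_le_mul_edgeBdry u
    (w := v i) (hu ▸ AddSubgroup.mem_top _)
  refine ⟨∑ i, K i, fun S => ?_⟩
  rw [Finset.sum_mul]
  exact Finset.sum_le_sum fun i _ => hK i S

/-- The standard generators of `ℤ^d`. -/
def stdGen (d : ℕ) : Fin d → (Fin d → ℤ) := fun j => Pi.single j 1

theorem closure_range_stdGen (d : ℕ) : AddSubgroup.closure (Set.range (stdGen d)) = ⊤ := by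
  refine (AddSubgroup.eq_top_iff' _).2 fun x => ?_
  rw [← Finset.univ_sum_single x]
  refine AddSubgroup.sum_mem _ fun j _ => ?_
  have : Pi.single j (x j) = x j • stdGen d j := by
    rw [stdGen, ← Pi.single_smul, smul_eq_mul, mul_one]
  rw [this]
  exact AddSubgroup.zsmul_mem _ (AddSubgroup.subset_closure (Set.mem_range_self j)) _

theorem exists_update_mem_add_stdGen_notMem {d : ℕ} {S : Finset (Fin d → ℤ)} {x : Fin d → ℤ}
    (hx : x ∈ S) (j : Fin d) :
    ∃ t : ℤ, Function.update x j t ∈ S ∧ Function.update x j t + stdGen d j ∉ S := by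
  have hne : (S.filter fun y => Function.update x j (y j) = y).Nonempty :=
    ⟨x, by simp [hx]⟩
  obtain ⟨y, hy, hmax⟩ := Finset.exists_max_image _ (fun y => y j) hne
  rw [Finset.mem_filter] at hy
  refine ⟨y j, by rw [hy.2]; exact hy.1, fun hmem => ?_⟩
  have heq : Function.update x j (y j) + stdGen d j = Function.update x j (y j + 1) := by
    ext i
    by_cases hi : i = j
    · subst hi; simp [stdGen]
    · simp [stdGen, hi]
  rw [heq] at hmem
  have := hmax _ (Finset.mem_filter.2 ⟨hmem, by simp⟩)
  simp at this

/-- A subset of `T` that is downward closed in the lower set `T` can have any cardinality. -/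
theorem exists_isLowerSet_card_eq {α : Type*} [PartialOrder α] [DecidableEq α] (T : Finset α)
    {n : ℕ} (hn : n ≤ T.card) :
    ∃ S ⊆ T, S.card = n ∧ ∀ x ∈ S, ∀ y ∈ T, y ≤ x → y ∈ S := by
  induction hn using Nat.decreasingInduction with
  | self => exact ⟨T, subset_rfl, rfl, fun _ _ y hy _ => hy⟩
  | of_succ m _ ih =>
    obtain ⟨S, hST, hcard, hlow⟩ := ih
    obtain ⟨a, ha⟩ := S.exists_maximal (Finset.card_pos.1 (by omega))
    refine ⟨S.erase a, (Finset.erase_subset _ _).trans hST, by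
      rw [Finset.card_erase_of_mem ha.1, hcard]; rfl, fun x hx y hy hyx => ?_⟩
    rw [Finset.mem_erase] at hx ⊢
    refine ⟨?_, hlow x hx.2 y hy hyx⟩
    rintro rfl
    exact hx.1 (le_antisymm (ha.2 hx.2 hyx) hyx)

open Finset in
theorem exists_edgeBdry_stdGen_le {d n m : ℕ} (hn : n ≤ m ^ d) :
    ∃ S : Finset (Fin d → ℤ), S.card = n ∧ edgeBdry (stdGen d) S ≤ d * m ^ (d - 1) := by
  obtain ⟨S, hS, hcard, hlow⟩ := exists_isLowerSet_card_eq
    (Fintype.piFinset fun _ : Fin d => Ico (0 : ℤ) m) (n := n) (by simpa using hn)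
  refine ⟨S, hcard, ?_⟩
  have key (j : Fin d) : #{v ∈ S | v + stdGen d j ∉ S} ≤ m ^ (d - 1) := by
    have hle : #{v ∈ S | v + stdGen d j ∉ S} ≤
        #(Fintype.piFinset fun i : Fin d => if i = j then {0} else Ico (0 : ℤ) m) := by
      refine card_le_card_of_injOn (fun v => Function.update v j 0) ?_ ?_
      · intro v hv
        simp only [coe_filter, Set.mem_ofPred_eq] at hv
        have hv' := Fintype.mem_piFinset.1 (hS hv.1)
        refine mem_coe.2 (Fintype.mem_piFinset.2 fun i => ?_)
        by_cases hi : i = j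
        · subst hi; simp
        · simpa [hi] using hv' i
      · have hlt (v w : Fin d → ℤ) (hv : v ∈ S ∧ v + stdGen d j ∉ S) (hw : w ∈ S)
            (hvw : ∀ i, i ≠ j → v i = w i) : w j ≤ v j := by
          by_contra! hlt
          have hle : v + stdGen d j ≤ w := by
            intro i
            by_cases hi : i = j
            · subst hi
              simpa [stdGen] using hlt
            · simp [stdGen, hi, hvw i hi]
          refine hv.2 (hlow w hw _ (Fintype.mem_piFinset.2 fun i => ?_) hle)
          have h₁ := mem_Ico.1 (Fintype.mem_piFinset.1 (hS hv.1) i)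
          have h₂ := mem_Ico.1 (Fintype.mem_piFinset.1 (hS hw) i)
          have h₃ : 0 ≤ stdGen d j i := by
            by_cases hi : i = j
            · subst hi; simp [stdGen]
            · simp [stdGen, hi]
          have h₄ := hle i
          simp only [Pi.add_apply] at h₄
          rw [mem_Ico, Pi.add_apply]
          omega
        intro v hv w hw hvw
        simp only [coe_filter, Set.mem_ofPred_eq] at hv hw
        have hoff (i : Fin d) (hi : i ≠ j) : v i = w i := by
          simpa [hi] using congrFun hvw i
        ext i
        by_cases hi : i = j
        · subst hi
          exact le_antisymm (hlt w v hw hv.1 fun i hi => (hoff i hi).symm) (hlt v w hv hw.1 hoff)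
        · exact hoff i hi
    refine hle.trans (le_of_eq ?_)
    rw [Fintype.card_piFinset, ← mul_prod_erase univ _ (mem_univ j)]
    rw [prod_congr rfl (g := fun _ => m) (fun i hi => by simp [ne_of_mem_erase hi])]
    simp
  calc edgeBdry (stdGen d) S ≤ ∑ _j : Fin d, m ^ (d - 1) := sum_le_sum fun j _ => key j
    _ = d * m ^ (d - 1) := by simp

open MeasureTheory in
theorem lintegral_pi_count {d : ℕ} (f : (Fin d → ℤ) → ENNReal) :
    ∫⁻ x, f x ∂(Measure.pi fun _ : Fin d => (Measure.count : Measure ℤ)) = ∑' x, f x := by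
  simp [lintegral_countable', Measure.pi_singleton]

open MeasureTheory in
theorem card_le_edgeBdry_stdGen_rpow {d : ℕ} {p : ℝ} (hp : Real.HolderConjugate d p)
    (S : Finset (Fin d → ℤ)) :
    (S.card : ENNReal) ≤ (edgeBdry (stdGen d) S : ENNReal) ^ p := by
  let f : (Fin d → ℤ) → ENNReal := fun x =>
    ∑ j, if x ∈ S ∧ x + stdGen d j ∉ S then 1 else 0
  have hsum : ∑' x, f x = edgeBdry (stdGen d) S := by
    rw [tsum_eq_sum (s := S) (fun x hx => by simp [f, hx]), Finset.sum_comm, edgeBdry,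
      Nat.cast_sum]
    refine Finset.sum_congr rfl fun j _ => ?_
    rw [Finset.card_filter, Nat.cast_sum]
    refine Finset.sum_congr rfl fun x hx => ?_
    simp [hx]
  have hcard : ∑' x, (if x ∈ S then (1 : ENNReal) else 0) = S.card := by
    rw [tsum_eq_sum (s := S) (fun x hx => by simp [hx])]
    simp
  have hgrid := lintegral_prod_lintegral_pow_le (fun _ : Fin d => (Measure.count : Measure ℤ))
    (p := p) (by simpa using hp) (measurable_of_countable f)
  rw [lintegral_pi_count, lintegral_pi_count, hsum] at hgrid
  refine le_trans ?_ hgrid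
  rw [← hcard]
  refine ENNReal.tsum_le_tsum fun x => ?_
  split_ifs with hx
  · refine Finset.one_le_prod' fun j _ => ENNReal.one_le_rpow ?_ ?_
    · obtain ⟨t, ht⟩ := exists_update_mem_add_stdGen_notMem hx j
      rw [lintegral_count]
      refine le_trans ?_ (ENNReal.le_tsum t)
      refine le_trans ?_ (Finset.single_le_sum (fun _ _ => zero_le) (Finset.mem_univ j))
      simp [ht]
    · have := hp.lt
      rw [Fintype.card_fin]
      exact one_div_pos.2 (by linarith)
  · exact zero_le

theorem card_rpow_le_edgeBdry_stdGen {d : ℕ} (hd : 1 ≤ d) {S : Finset (Fin d → ℤ)}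
    (hS : S.Nonempty) :
    (S.card : ℝ) ^ (1 - (1 : ℝ) / d) ≤ edgeBdry (stdGen d) S := by
  obtain rfl | hd := hd.eq_or_lt
  · obtain ⟨x, hx⟩ := hS
    obtain ⟨t, ht⟩ := exists_update_mem_add_stdGen_notMem hx 0
    have : 0 < edgeBdry (stdGen 1) S := by
      simp only [edgeBdry, Fin.sum_univ_one]
      exact Finset.card_pos.2 ⟨_, Finset.mem_filter.2 ht⟩
    simpa using Nat.one_le_iff_ne_zero.2 this.ne'
  · have hp := Real.HolderConjugate.conjExponent (p := (d : ℝ)) (by exact_mod_cast hd)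
    have h := card_le_edgeBdry_stdGen_rpow hp S
    have hexp : 1 - (1 : ℝ) / d = (Real.conjExponent d)⁻¹ := by
      rw [one_div, ← hp.inv_add_inv_eq_one, add_sub_cancel_left]
    rw [hexp, Real.rpow_inv_le_iff_of_pos (by positivity) (by positivity) hp.symm.pos]
    have h' := ENNReal.toReal_mono (by simp [ENNReal.rpow_eq_top_iff, hp.symm.nonneg, not_lt]) h
    simpa [← ENNReal.toReal_rpow] using h'

theorem exists_card_eq_and_edgeBdry_eq_edgeOpt {d k : ℕ} (hd : 1 ≤ d)
    (u : Fin k → (Fin d → ℤ)) (n : ℕ) :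
    ∃ S : Finset (Fin d → ℤ), S.card = n ∧ edgeBdry u S = edgeOpt u n := by
  obtain ⟨S, hS, -⟩ := exists_edgeBdry_stdGen_le (d := d) (n := n) (m := n)
    (Nat.le_self_pow (by omega) n)
  exact Nat.sInf_mem (s := {m | ∃ S : Finset (Fin d → ℤ), S.card = n ∧ edgeBdry u S = m})
    ⟨_, S, hS, rfl⟩

theorem exists_le_pow_and_pow_pred_le {d n : ℕ} (hd : 1 ≤ d) (hn : 1 ≤ n) :
    ∃ m : ℕ, n ≤ m ^ d ∧ (m : ℝ) ^ (d - 1) ≤ 2 ^ (d - 1) * (n : ℝ) ^ (1 - (1 : ℝ) / d) := by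
  have hd0 : (d : ℝ) ≠ 0 := by positivity
  have hn' : (1 : ℝ) ≤ n := by exact_mod_cast hn
  have hr : 1 ≤ (n : ℝ) ^ ((1 : ℝ) / d) := Real.one_le_rpow hn' (by positivity)
  refine ⟨⌈(n : ℝ) ^ ((1 : ℝ) / d)⌉₊, ?_, ?_⟩
  · have h : ((n : ℝ) ^ ((1 : ℝ) / d)) ^ d ≤ (⌈(n : ℝ) ^ ((1 : ℝ) / d)⌉₊ : ℝ) ^ d := by
      gcongr
      exact Nat.le_ceil _
    rw [← Real.rpow_natCast, ← Real.rpow_mul (by positivity), one_div_mul_cancel hd0,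
      Real.rpow_one] at h
    exact_mod_cast h
  · have h : (⌈(n : ℝ) ^ ((1 : ℝ) / d)⌉₊ : ℝ) ≤ 2 * (n : ℝ) ^ ((1 : ℝ) / d) := by
      have := Nat.ceil_lt_add_one (a := (n : ℝ) ^ ((1 : ℝ) / d)) (by positivity)
      linarith
    have hexp : (n : ℝ) ^ (1 - (1 : ℝ) / d) = ((n : ℝ) ^ ((1 : ℝ) / d)) ^ (d - 1) := by
      rw [← Real.rpow_natCast, ← Real.rpow_mul (by positivity), Nat.cast_sub hd]
      congr 1
      field_simp
      simp
    rw [hexp, ← mul_pow]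
    gcongr

theorem edgeOpt_order_of_growth (d k : ℕ) (hd : 1 ≤ d)
    (u : Fin k → (Fin d → ℤ)) (hu : ∀ i, u i ≠ 0)
    (hgen : AddSubgroup.closure (Set.range u) = ⊤) :
    ∃ c C : ℝ, 0 < c ∧ c < C ∧ ∀ n : ℕ, 1 ≤ n →
      c * (n : ℝ) ^ (1 - (1 : ℝ) / d) ≤ (edgeOpt u n : ℝ) ∧
      (edgeOpt u n : ℝ) ≤ C * (n : ℝ) ^ (1 - (1 : ℝ) / d) := by
  obtain ⟨K, hK⟩ := exists_edgeBdry_le_mul_edgeBdry hgen (stdGen d)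
  obtain ⟨L, hL⟩ := exists_edgeBdry_le_mul_edgeBdry (closure_range_stdGen d) u
  refine ⟨1 / (K + 1), L * (d * 2 ^ (d - 1)) + 2, by positivity, ?_, fun n hn => ⟨?_, ?_⟩⟩
  · have h₁ : (1 : ℝ) / (K + 1) ≤ 1 := (div_le_one (by positivity)).2 (by simp)
    have h₂ : (0 : ℝ) ≤ L * (d * 2 ^ (d - 1)) := by positivity
    linarith
  · obtain ⟨S, hS, hopt⟩ := exists_card_eq_and_edgeBdry_eq_edgeOpt hd u n
    have h := card_rpow_le_edgeBdry_stdGen hd (S := S) (Finset.card_pos.1 (by omega))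
    have hKS : (edgeBdry (stdGen d) S : ℝ) ≤ K * edgeBdry u S := by exact_mod_cast hK S
    rw [← hopt, ← hS, one_div_mul_eq_div, div_le_iff₀ (by positivity)]
    have h₀ : (0 : ℝ) ≤ edgeBdry u S := by positivity
    linarith
  · obtain ⟨m, hnm, hm⟩ := exists_le_pow_and_pow_pred_le hd hn
    obtain ⟨S, hS, hSm⟩ := exists_edgeBdry_stdGen_le hnm
    have hle : edgeOpt u n ≤ edgeBdry u S := Nat.sInf_le ⟨S, hS, rfl⟩
    calc (edgeOpt u n : ℝ) ≤ L * (d * (m : ℝ) ^ (d - 1)) := by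
          exact_mod_cast (hle.trans (hL S)).trans (Nat.mul_le_mul_left L hSm)
      _ ≤ L * (d * (2 ^ (d - 1) * (n : ℝ) ^ (1 - (1 : ℝ) / d))) := by gcongr
      _ = (L * (d * 2 ^ (d - 1))) * (n : ℝ) ^ (1 - (1 : ℝ) / d) := by ring
      _ ≤ _ := by
        gcongr
        simp
end

section
/- Let d ≥ 1 and let U = {u_1, …, u_k} be a finite set of non-zero vectors in ℤ^d. Let S ⊆ ℤ^d be finite, and for i ∈ [k] let F_i = {v ∈ S : v + u_i ∉ S} be the frontier of S in the u_i-direction. Then for all i, j ∈ [k], ∂_j(S_i) − ∂_j(S) ≤ ∂_j(S) − ∂_j(S \ F_i), where S_i = S + {0, u_i}. -/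
open Pointwise

/-- Contribution to the edge boundary of `S` in the `u j`-direction. -/
def dirBdry {d k : ℕ} (u : Fin k → (Fin d → ℤ)) (j : Fin k)
    (S : Finset (Fin d → ℤ)) : ℕ :=
  (S.filter (fun v => v + u j ∉ S)).card

theorem dirBdry_eq_sum {d k : ℕ} (u : Fin k → (Fin d → ℤ)) (j : Fin k)
    {X T : Finset (Fin d → ℤ)} (h : X ⊆ T) :
    dirBdry u j X = ∑ v ∈ T, if v ∈ X ∧ v + u j ∉ X then 1 else 0 := by
  rw [dirBdry, ← Finset.card_filter]
  congr 1
  ext v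
  simp only [Finset.mem_filter]
  exact ⟨fun hv => ⟨h hv.1, hv⟩, fun hv => hv.2⟩

/-- The directional edge boundary is submodular. -/
theorem dirBdry_union_add_dirBdry_inter_le {d k : ℕ} (u : Fin k → (Fin d → ℤ)) (j : Fin k)
    (A B : Finset (Fin d → ℤ)) :
    dirBdry u j (A ∪ B) + dirBdry u j (A ∩ B) ≤ dirBdry u j A + dirBdry u j B := by
  rw [dirBdry_eq_sum u j (Finset.Subset.refl (A ∪ B)),
    dirBdry_eq_sum u j (Finset.inter_subset_union (s := A) (t := B)),
    dirBdry_eq_sum u j (Finset.subset_union_left (s₁ := A) (s₂ := B)),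
    dirBdry_eq_sum u j (Finset.subset_union_right (s₁ := A) (s₂ := B)),
    ← Finset.sum_add_distrib, ← Finset.sum_add_distrib]
  refine Finset.sum_le_sum fun v _ => ?_
  simp only [Finset.mem_union, Finset.mem_inter]
  by_cases h₁ : v ∈ A <;> by_cases h₂ : v ∈ B <;> by_cases h₃ : v + u j ∈ A <;>
    by_cases h₄ : v + u j ∈ B <;> simp [h₁, h₂, h₃, h₄]

/-- The directional edge boundary is translation invariant. -/
theorem dirBdry_image_add_right {d k : ℕ} (u : Fin k → (Fin d → ℤ)) (j : Fin k)
    (S : Finset (Fin d → ℤ)) (a : Fin d → ℤ) :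
    dirBdry u j (S.image (· + a)) = dirBdry u j S := by
  rw [dirBdry, Finset.filter_image, Finset.card_image_of_injective _ (add_left_injective a),
    dirBdry]
  congr 1
  refine Finset.filter_congr fun v _ => ?_
  rw [add_right_comm, (add_left_injective a).mem_finset_image]

theorem pushing_frontier_inequality (d k : ℕ) (hd : 1 ≤ d)
    (u : Fin k → (Fin d → ℤ)) (hu : ∀ i, u i ≠ 0)
    (S : Finset (Fin d → ℤ)) (i j : Fin k) :
    (dirBdry u j (S + ({0, u i} : Finset (Fin d → ℤ))) : ℤ) - (dirBdry u j S : ℤ)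
      ≤ (dirBdry u j S : ℤ)
        - (dirBdry u j (S \ (S.filter (fun v => v + u i ∉ S))) : ℤ) := by
  have hunion : S + ({0, u i} : Finset (Fin d → ℤ)) = S ∪ S.image (· + u i) := by
    ext v
    simp only [Finset.mem_add, Finset.mem_insert, Finset.mem_singleton, Finset.mem_union,
      Finset.mem_image]
    constructor
    · rintro ⟨x, hx, y, rfl | rfl, rfl⟩
      · exact Or.inl (by simpa using hx)
      · exact Or.inr ⟨x, hx, rfl⟩
    · rintro (hv | ⟨x, hx, rfl⟩)
      · exact ⟨v, hv, 0, Or.inl rfl, add_zero v⟩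
      · exact ⟨x, hx, u i, Or.inr rfl, rfl⟩
  have hinter : S ∩ S.image (· + u i) =
      (S \ (S.filter (fun v => v + u i ∉ S))).image (· + u i) := by
    ext v
    simp only [Finset.mem_inter, Finset.mem_image, Finset.mem_sdiff, Finset.mem_filter]
    constructor
    · rintro ⟨hv, x, hx, rfl⟩
      exact ⟨x, ⟨hx, fun h => h.2 hv⟩, rfl⟩
    · rintro ⟨x, ⟨hx, h⟩, rfl⟩
      exact ⟨by_contra fun hn => h ⟨hx, hn⟩, x, hx, rfl⟩
  have h := dirBdry_union_add_dirBdry_inter_le u j S (S.image (· + u i))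
  rw [← hunion, hinter, dirBdry_image_add_right, dirBdry_image_add_right] at h
  omega
end

section
/- Let d ≥ 1 and let U = {u_1, …, u_k} be a finite set of non-zero vectors in ℤ^d that generate ℤ^d as a group. There exist constants (C_t)_{t=0}^∞ such that: for every t ∈ ℕ and every 0 < ε < 1 there exists n_0 = n_0(ε, t) such that, if S ⊆ ℤ^d is finite with |S| ≥ n_0 and ∂(S) ≤ (1+ε)∂*(|S|), then for every x ∈ [k]^t, |S_x| − |S| ≤ C_t |S|^{1−1/d}, where S_x = S + {0, u_{x_1}} + ⋯ + {0, u_{x_t}}. -/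
open Pointwise

theorem card_pushed_sdiff_singleton_le {d k : ℕ} (u : Fin k → (Fin d → ℤ))
    (S : Finset (Fin d → ℤ)) (i : Fin k) :
    ((S + {u i}) \ S).card ≤ edgeBdry u S := by
  have h : (S + {u i}) \ S ⊆ (S.filter (fun v => v + u i ∉ S)).image (· + u i) := by
    intro v hv
    obtain ⟨hv, hvS⟩ := Finset.mem_sdiff.1 hv
    obtain ⟨s, hs, _, hw, rfl⟩ := Finset.mem_add.1 hv
    obtain rfl := Finset.mem_singleton.1 hw
    exact Finset.mem_image.2 ⟨s, Finset.mem_filter.2 ⟨hs, hvS⟩, rfl⟩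
  exact (Finset.card_le_card h).trans (Finset.card_image_le.trans
    (Finset.single_le_sum (f := fun i => (S.filter (fun v => v + u i ∉ S)).card)
      (fun _ _ => Nat.zero_le _) (Finset.mem_univ i)))

theorem card_add_pair_sdiff_le {d k : ℕ} (u : Fin k → (Fin d → ℤ))
    (S A : Finset (Fin d → ℤ)) (i : Fin k) :
    ((A + {0, u i}) \ S).card ≤ 2 * (A \ S).card + edgeBdry u S := by
  have h : (A + {0, u i}) \ S ⊆ ((A \ S) ∪ ((A \ S) + {u i})) ∪ ((S + {u i}) \ S) := by
    intro v hv
    obtain ⟨hv, hvS⟩ := Finset.mem_sdiff.1 hv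
    obtain ⟨a, ha, w, hw, rfl⟩ := Finset.mem_add.1 hv
    rcases Finset.mem_insert.1 hw with rfl | hw
    · rw [add_zero] at hvS ⊢
      simp [ha, hvS]
    · by_cases haS : a ∈ S
      · exact Finset.mem_union_right _
          (Finset.mem_sdiff.2 ⟨Finset.add_mem_add haS hw, hvS⟩)
      · exact Finset.mem_union_left _ (Finset.mem_union_right _
          (Finset.add_mem_add (Finset.mem_sdiff.2 ⟨ha, haS⟩) hw))
  have h₁ := Finset.card_le_card h
  have h₂ := Finset.card_union_le ((A \ S) ∪ ((A \ S) + {u i})) ((S + {u i}) \ S)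
  have h₃ := Finset.card_union_le (A \ S) ((A \ S) + {u i})
  have h₄ : ((A \ S) + {u i}).card ≤ (A \ S).card := by
    simp
  have h₅ := card_pushed_sdiff_singleton_le u S i
  omega

theorem card_pushed_sdiff_le {d k : ℕ} (u : Fin k → (Fin d → ℤ)) (S : Finset (Fin d → ℤ))
    (t : ℕ) (x : Fin t → Fin k) :
    ((S + ∑ j, ({0, u (x j)} : Finset (Fin d → ℤ))) \ S).card + edgeBdry u S
      ≤ 2 ^ t * edgeBdry u S := by
  induction t with
  | zero => simp
  | succ t ih =>
    rw [Fin.sum_univ_castSucc, ← add_assoc]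
    have h₁ := card_add_pair_sdiff_le u S
      (S + ∑ j : Fin t, ({0, u (x j.castSucc)} : Finset (Fin d → ℤ))) (x (Fin.last t))
    have h₂ := ih (fun j => x j.castSucc)
    rw [pow_succ]
    linarith

theorem edgeBdry_le_of_cube_subset {d k : ℕ} (u : Fin k → (Fin d → ℤ)) (M m : ℕ)
    (hM : ∀ i j, |u i j| ≤ M) (hm : 2 * M ≤ m) (S : Finset (Fin d → ℤ))
    (hS : Fintype.piFinset (fun _ : Fin d => Finset.Ico (0 : ℤ) m) ⊆ S) :
    edgeBdry u S ≤ k * (S.card - (m - 2 * M) ^ d) := by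
  set Q := Fintype.piFinset (fun _ : Fin d => Finset.Ico (M : ℤ) (m - M)) with hQ
  have hcard : Q.card = (m - 2 * M) ^ d := by
    simp only [hQ, Fintype.card_piFinset, Int.card_Ico, Finset.prod_const, Finset.card_univ]
    rw [Fintype.card_fin]
    congr 1
    omega
  have hQS : Q ⊆ S := by
    refine fun v hv => hS (Fintype.mem_piFinset.2 fun j => ?_)
    have := Finset.mem_Ico.1 (Fintype.mem_piFinset.1 hv j)
    exact Finset.mem_Ico.2 (by omega)
  have h (i : Fin k) : (S.filter (fun v => v + u i ∉ S)).card ≤ S.card - (m - 2 * M) ^ d := by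
    rw [← hcard, ← Finset.card_sdiff_of_subset hQS]
    refine Finset.card_le_card fun v hv => ?_
    obtain ⟨hv, hvu⟩ := Finset.mem_filter.1 hv
    refine Finset.mem_sdiff.2 ⟨hv, fun hvQ => hvu (hS (Fintype.mem_piFinset.2 fun j => ?_))⟩
    have h₁ := Finset.mem_Ico.1 (Fintype.mem_piFinset.1 hvQ j)
    have h₂ := abs_le.1 (hM i j)
    simp only [Pi.add_apply]
    exact Finset.mem_Ico.2 (by omega)
  calc edgeBdry u S ≤ ∑ _i : Fin k, (S.card - (m - 2 * M) ^ d) := Finset.sum_le_sum fun i _ => h i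
    _ = _ := by simp

theorem edgeOpt_le_of_pow_le {d k : ℕ} (u : Fin k → (Fin d → ℤ)) (M m n : ℕ)
    (hM : ∀ i j, |u i j| ≤ M) (hm : 2 * M ≤ m) (hn : m ^ d ≤ n) (hn' : n ≤ (m + 1) ^ d) :
    edgeOpt u n ≤ k * (n - (m - 2 * M) ^ d) := by
  have hsub : Fintype.piFinset (fun _ : Fin d => Finset.Ico (0 : ℤ) m) ⊆
      Fintype.piFinset (fun _ : Fin d => Finset.Ico (0 : ℤ) (m + 1)) :=
    Fintype.piFinset_subset _ _ fun _ => Finset.Ico_subset_Ico_right (by omega)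
  obtain ⟨S, hS, -, rfl⟩ := Finset.exists_subsuperset_card_eq hsub (n := n)
    (by simpa [Fintype.card_piFinset_const] using hn)
    (by
      simpa only [Fintype.card_piFinset, Int.card_Ico, Finset.prod_const, Finset.card_univ,
        Fintype.card_fin, sub_zero, Int.toNat_natCast_add_one] using hn')
  have hopt : edgeOpt u S.card ≤ edgeBdry u S := Nat.sInf_le ⟨S, rfl, rfl⟩
  exact hopt.trans (edgeBdry_le_of_cube_subset u M m hM hm S hS)

theorem edgeOpt_le_rpow {d k : ℕ} (hd : 1 ≤ d) (u : Fin k → (Fin d → ℤ)) (M n : ℕ)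
    (hM : ∀ i j, |u i j| ≤ M) (hn : (2 * M + 1) ^ d ≤ n) :
    (edgeOpt u n : ℝ) ≤
      (k * (d * (2 * M + 1) * 2 ^ (d - 1))) * (n : ℝ) ^ (1 - (1 : ℝ) / d) := by
  have hd₀ : (d : ℝ) ≠ 0 := by positivity
  set r : ℝ := (n : ℝ) ^ ((1 : ℝ) / d) with hr
  have hr₀ : 0 ≤ r := by positivity
  have hrd : r ^ d = n := by
    rw [hr, ← Real.rpow_natCast, ← Real.rpow_mul (Nat.cast_nonneg n), one_div_mul_cancel hd₀,
      Real.rpow_one]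
  have hrd' : (n : ℝ) ^ (1 - (1 : ℝ) / d) = r ^ (d - 1) := by
    rw [hr, ← Real.rpow_natCast, ← Real.rpow_mul (Nat.cast_nonneg n), Nat.cast_sub hd]
    congr 1
    field_simp
    simp
  have hMr : ((2 * M + 1 : ℕ) : ℝ) ≤ r := by
    refine le_of_pow_le_pow_left₀ (by omega : d ≠ 0) hr₀ ?_
    rw [hrd]
    exact_mod_cast hn
  set m := ⌊r⌋₊ with hm
  have hMm : 2 * M + 1 ≤ m := Nat.le_floor hMr
  have hmr : (m : ℝ) ≤ r := Nat.floor_le hr₀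
  have hrm : r ≤ m + 1 := (Nat.lt_floor_add_one r).le
  have hmn : m ^ d ≤ n := by
    have : (m : ℝ) ^ d ≤ r ^ d := by gcongr
    rw [hrd] at this
    exact_mod_cast this
  have hnm : n ≤ (m + 1) ^ d := by
    have : r ^ d ≤ ((m : ℝ) + 1) ^ d := by gcongr
    rw [hrd] at this
    exact_mod_cast this
  have hopt := edgeOpt_le_of_pow_le u M m n hM (by omega) hmn hnm
  have hle : (m - 2 * M) ^ d ≤ n := (Nat.pow_le_pow_left (Nat.sub_le _ _) d).trans hmn
  have hm₁ : (1 : ℝ) ≤ m := by exact_mod_cast (by omega : 1 ≤ m)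
  have hdiff : (n : ℝ) - ((m : ℝ) - 2 * M) ^ d ≤ d * (2 * M + 1) * 2 ^ (d - 1) * r ^ (d - 1) := by
    have hcast : (2 * M + 1 : ℝ) ≤ m := by exact_mod_cast hMm
    have hM₀ : (0 : ℝ) ≤ M := Nat.cast_nonneg M
    have h₁ := abs_pow_sub_pow_le ((m : ℝ) + 1) ((m : ℝ) - 2 * M) d
    have h₂ : max |(m : ℝ) + 1| |(m : ℝ) - 2 * M| = m + 1 := by
      rw [abs_of_nonneg (by linarith), abs_of_nonneg (by linarith)]
      exact max_eq_left (by linarith)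
    have h₃ : |(m : ℝ) + 1 - (m - 2 * M)| = 2 * M + 1 := by
      rw [abs_of_nonneg (by linarith)]
      ring
    rw [h₂, h₃] at h₁
    have h₄ : ((m : ℝ) + 1) ^ (d - 1) ≤ 2 ^ (d - 1) * r ^ (d - 1) := by
      rw [← mul_pow]
      gcongr
      linarith
    have h₅ : (n : ℝ) ≤ (m + 1) ^ d := by exact_mod_cast hnm
    calc (n : ℝ) - ((m : ℝ) - 2 * M) ^ d ≤ (m + 1) ^ d - ((m : ℝ) - 2 * M) ^ d := by linarith
      _ ≤ (2 * M + 1) * d * (m + 1) ^ (d - 1) := (le_abs_self _).trans h₁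
      _ ≤ (2 * M + 1) * d * (2 ^ (d - 1) * r ^ (d - 1)) := by gcongr
      _ = _ := by ring
  calc (edgeOpt u n : ℝ) ≤ ((k * (n - (m - 2 * M) ^ d) : ℕ) : ℝ) := by exact_mod_cast hopt
    _ = k * ((n : ℝ) - ((m : ℝ) - 2 * M) ^ d) := by
      rw [Nat.cast_mul, Nat.cast_sub hle, Nat.cast_pow, Nat.cast_sub (by omega)]
      push_cast
      rfl
    _ ≤ k * (d * (2 * M + 1) * 2 ^ (d - 1) * r ^ (d - 1)) := by gcongr
    _ = _ := by rw [hrd']; ring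

theorem pushed_set_size_growth (d k : ℕ) (hd : 1 ≤ d)
    (u : Fin k → (Fin d → ℤ)) (hu : ∀ i, u i ≠ 0)
    (hgen : AddSubgroup.closure (Set.range u) = ⊤) :
    ∃ C : ℕ → ℝ, ∀ t : ℕ, ∀ ε : ℝ, 0 < ε → ε < 1 →
      ∃ n₀ : ℕ, ∀ S : Finset (Fin d → ℤ), n₀ ≤ S.card →
        (edgeBdry u S : ℝ) ≤ (1 + ε) * (edgeOpt u S.card : ℝ) →
        ∀ x : Fin t → Fin k,
          ((S + ∑ j, ({0, u (x j)} : Finset (Fin d → ℤ))).card : ℝ) - (S.card : ℝ)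
            ≤ C t * (S.card : ℝ) ^ (1 - (1 : ℝ) / d) := by
  obtain ⟨M, hM⟩ : ∃ M : ℕ, ∀ i j, |u i j| ≤ M := by
    refine ⟨∑ i, ∑ j, (u i j).natAbs, fun i j => ?_⟩
    rw [Int.abs_eq_natAbs, Nat.cast_le]
    exact (Finset.single_le_sum (f := fun j => (u i j).natAbs) (fun _ _ => Nat.zero_le _)
      (Finset.mem_univ j)).trans (Finset.single_le_sum (f := fun i => ∑ j, (u i j).natAbs)
      (fun _ _ => Nat.zero_le _) (Finset.mem_univ i))
  refine ⟨fun t => 2 ^ t * (2 * (k * (d * (2 * M + 1) * 2 ^ (d - 1)))), fun t ε _ hε =>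
    ⟨(2 * M + 1) ^ d, fun S hS hbdry x => ?_⟩⟩
  set P := S + ∑ j, ({0, u (x j)} : Finset (Fin d → ℤ)) with hP
  have hcard : P.card ≤ (P \ S).card + S.card := by
    rw [Finset.card_sdiff_add_card]
    exact Finset.card_le_card Finset.subset_union_left
  have hpush : (P \ S).card ≤ 2 ^ t * edgeBdry u S :=
    le_of_add_le_left (card_pushed_sdiff_le u S t x)
  have hopt := edgeOpt_le_rpow hd u M S.card hM hS
  calc (P.card : ℝ) - S.card ≤ (2 : ℝ) ^ t * edgeBdry u S := by
        rw [sub_le_iff_le_add]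
        exact_mod_cast hcard.trans (by gcongr)
    _ ≤ 2 ^ t * (2 * edgeOpt u S.card) := by
        gcongr
        exact hbdry.trans (by gcongr; linarith)
    _ ≤ 2 ^ t * (2 * ((k * (d * (2 * M + 1) * 2 ^ (d - 1))) *
          (S.card : ℝ) ^ (1 - (1 : ℝ) / d))) := by gcongr
    _ = _ := by ring
end

section
/- Let d ≥ 1 and let U = {u_1, …, u_k} be a finite set of non-zero vectors in ℤ^d that generate ℤ^d as a group. For every t ∈ ℕ and every 0 < ε < 1 there exists n_0 = n_0(ε, t) such that, if S ⊆ ℤ^d is finite with |S| ≥ n_0 and ∂(S) ≤ (1+ε)∂*(|S|), then for every x ∈ [k]^t, ∂(S_x) ≤ (1 + 2·3^t ε) ∂*(|S|), where S_x = S + {0, u_{x_1}} + ⋯ + {0, u_{x_t}}. -/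
open Pointwise

section DirectionalBoundary

variable {G : Type*} [AddCommGroup G] [DecidableEq G]

theorem card_dirBdry_union_add_card_dirBdry_inter_le (v : G) (A B : Finset G) :
    ((A ∪ B).filter (fun x => x + v ∉ A ∪ B)).card + ((A ∩ B).filter (fun x => x + v ∉ A ∩ B)).card
      ≤ (A.filter (fun x => x + v ∉ A)).card + (B.filter (fun x => x + v ∉ B)).card := by
  rw [← Finset.card_union_add_card_inter, ← Finset.card_union_add_card_inter (A.filter _)]
  apply add_le_add <;> apply Finset.card_le_card <;> intro x <;>
    simp only [Finset.mem_union, Finset.mem_inter, Finset.mem_filter] <;> tauto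

theorem card_dirBdry_neg (v : G) (A : Finset G) :
    (A.filter (fun x => x + -v ∉ A)).card = (A.filter (fun x => x + v ∉ A)).card := by
  have h : (A.filter (fun x => x + -v ∈ A)).card = (A.filter (fun x => x + v ∈ A)).card := by
    refine Finset.card_bij' (fun x _ => x + -v) (fun x _ => x + v) ?_ ?_ ?_ ?_ <;>
      simp +contextual
  have h₁ := Finset.card_filter_add_card_filter_not (s := A) (fun x => x + -v ∈ A)
  have h₂ := Finset.card_filter_add_card_filter_not (s := A) (fun x => x + v ∈ A)
  omega

theorem card_dirBdry_image_add_right (v c : G) (A : Finset G) :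
    ((A.image (· + c)).filter (fun x => x + v ∉ A.image (· + c))).card
      = (A.filter (fun x => x + v ∉ A)).card := by
  rw [← Finset.card_image_of_injective (A.filter _) (add_left_injective c)]
  congr 1
  ext x
  simp only [Finset.mem_filter, Finset.mem_image]
  constructor
  · rintro ⟨⟨a, ha, rfl⟩, h⟩
    exact ⟨a, ⟨ha, fun h' => h ⟨_, h', by abel⟩⟩, rfl⟩
  · rintro ⟨a, ⟨ha, h⟩, rfl⟩
    refine ⟨⟨a, ha, rfl⟩, ?_⟩
    rintro ⟨b, hb, hab⟩
    refine h ?_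
    have : b = a + v := by
      apply add_right_cancel (b := c)
      rw [hab]; abel
    rwa [← this]

theorem card_le_card_inter_image_add_card_dirBdry (v : G) (A : Finset G) :
    A.card ≤ (A ∩ A.image (· + v)).card + (A.filter (fun x => x + v ∉ A)).card := by
  rw [← card_dirBdry_neg, ← Finset.card_filter_add_card_filter_not (s := A) (fun x => x + -v ∈ A)]
  gcongr
  intro x hx
  rw [Finset.mem_filter] at hx
  exact Finset.mem_inter.2 ⟨hx.1, Finset.mem_image.2 ⟨_, hx.2, by simp⟩⟩

theorem add_pair_zero_eq_union_image (v : G) (A : Finset G) :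
    A + {0, v} = A ∪ A.image (· + v) := by
  rw [Finset.insert_eq, Finset.add_union, Finset.singleton_zero, add_zero, Finset.add_singleton]
  rfl

end DirectionalBoundary

section EdgeBoundary

variable {d k : ℕ} (u : Fin k → (Fin d → ℤ))

theorem edgeBdry_union_add_edgeBdry_inter_le (A B : Finset (Fin d → ℤ)) :
    edgeBdry u (A ∪ B) + edgeBdry u (A ∩ B) ≤ edgeBdry u A + edgeBdry u B := by
  simp only [edgeBdry, ← Finset.sum_add_distrib]
  exact Finset.sum_le_sum fun i _ => card_dirBdry_union_add_card_dirBdry_inter_le (u i) A B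

theorem edgeBdry_image_add_right (c : Fin d → ℤ) (A : Finset (Fin d → ℤ)) :
    edgeBdry u (A.image (· + c)) = edgeBdry u A :=
  Finset.sum_congr rfl fun i _ => card_dirBdry_image_add_right (u i) c A

theorem card_le_card_inter_image_add_edgeBdry (i : Fin k) (A : Finset (Fin d → ℤ)) :
    A.card ≤ (A ∩ A.image (· + u i)).card + edgeBdry u A :=
  (card_le_card_inter_image_add_card_dirBdry (u i) A).trans <| Nat.add_le_add_left
    (Finset.single_le_sum (f := fun i => (A.filter (fun v => v + u i ∉ A)).card)
      (fun _ _ => Nat.zero_le _) (Finset.mem_univ i)) _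

theorem edgeBdry_erase_le_of_lex_min (hu : ∀ i, u i ≠ 0) {A : Finset (Fin d → ℤ)} {a : Fin d → ℤ}
    (ha : ∀ x ∈ A, toLex a ≤ toLex x) : edgeBdry u (A.erase a) ≤ edgeBdry u A := by
  have key : ∀ v : Fin d → ℤ, 0 < toLex v →
      ((A.erase a).filter (fun x => x + v ∉ A.erase a)).card
        ≤ (A.filter (fun x => x + v ∉ A)).card := by
    intro v hv
    refine Finset.card_le_card fun x hx => ?_
    simp only [Finset.mem_filter, Finset.mem_erase, not_and] at hx ⊢
    refine ⟨hx.1.2, hx.2 ?_⟩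
    rintro rfl
    have := ha x hx.1.2
    rw [toLex_add] at this
    exact absurd this (not_le.2 (lt_add_of_pos_right _ hv))
  refine Finset.sum_le_sum fun i _ => ?_
  rcases lt_trichotomy (toLex (u i)) 0 with h | h | h
  · rw [← card_dirBdry_neg, ← card_dirBdry_neg (u i) A]
    refine key _ ?_
    rw [toLex_neg]
    exact neg_pos.2 h
  · exact absurd h (hu i)
  · exact key _ h

theorem edgeOpt_card_le (A : Finset (Fin d → ℤ)) : edgeOpt u A.card ≤ edgeBdry u A :=
  Nat.sInf_le ⟨A, rfl, rfl⟩

theorem exists_edgeBdry_eq_edgeOpt [Infinite (Fin d → ℤ)] (n : ℕ) :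
    ∃ A : Finset (Fin d → ℤ), A.card = n ∧ edgeBdry u A = edgeOpt u n := by
  obtain ⟨A, hA⟩ := Infinite.exists_subset_card_eq (Fin d → ℤ) n
  exact Nat.sInf_mem (s := {m | ∃ S : Finset (Fin d → ℤ), S.card = n ∧ edgeBdry u S = m})
    ⟨_, A, hA, rfl⟩

theorem edgeOpt_mono [Infinite (Fin d → ℤ)] (hu : ∀ i, u i ≠ 0) : Monotone (edgeOpt u) := by
  refine monotone_nat_of_le_succ fun n => ?_
  obtain ⟨A, hA, hAu⟩ := exists_edgeBdry_eq_edgeOpt u (n + 1)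
  obtain ⟨a, haA, ha⟩ := A.exists_min_image toLex (Finset.card_pos.1 (by omega))
  have hcard : (A.erase a).card = n := by rw [Finset.card_erase_of_mem haA, hA]; rfl
  rw [← hAu, ← hcard]
  exact (edgeOpt_card_le u _).trans (edgeBdry_erase_le_of_lex_min u hu ha)

theorem edgeOpt_add_le [Infinite (Fin d → ℤ)] (m n : ℕ) :
    edgeOpt u (m + n) ≤ edgeOpt u m + edgeOpt u n := by
  obtain ⟨A, rfl, hA⟩ := exists_edgeBdry_eq_edgeOpt u m
  obtain ⟨B, rfl, hB⟩ := exists_edgeBdry_eq_edgeOpt u n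
  obtain ⟨c, hc⟩ := Infinite.exists_notMem_finset (A - B)
  have hdisj : Disjoint A (B.image (· + c)) := by
    rw [Finset.disjoint_left]
    intro x hx hxB
    obtain ⟨b, hb, rfl⟩ := Finset.mem_image.1 hxB
    exact hc (Finset.mem_sub.2 ⟨_, hx, b, hb, by simp⟩)
  have hcard : (A ∪ B.image (· + c)).card = A.card + B.card := by
    rw [Finset.card_union_of_disjoint hdisj,
      Finset.card_image_of_injective _ (add_left_injective c)]
  have h₁ := edgeOpt_card_le u (A ∪ B.image (· + c))
  have h₂ := edgeBdry_union_add_edgeBdry_inter_le u A (B.image (· + c))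
  rw [edgeBdry_image_add_right] at h₂
  rw [hcard] at h₁
  omega

theorem edgeOpt_zero : edgeOpt u 0 = 0 := by
  simpa [edgeBdry] using edgeOpt_card_le u ∅

theorem edgeOpt_mul_le [Infinite (Fin d → ℤ)] (a q : ℕ) : edgeOpt u (a * q) ≤ a * edgeOpt u q := by
  induction a with
  | zero => simp [edgeOpt_zero]
  | succ a ih =>
    have := edgeOpt_add_le u (a * q) q
    rw [add_mul, one_mul, add_mul, one_mul]
    omega

theorem exists_forall_abs_apply_le : ∃ M : ℕ, ∀ i j, |u i j| ≤ M := by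
  refine ⟨∑ i, ∑ j, (u i j).natAbs, fun i j => ?_⟩
  have h₁ := Finset.single_le_sum (f := fun j => (u i j).natAbs) (fun _ _ => Nat.zero_le _)
    (Finset.mem_univ j)
  have h₂ := Finset.single_le_sum (f := fun i => ∑ j, (u i j).natAbs) (fun _ _ => Nat.zero_le _)
    (Finset.mem_univ i)
  rw [Int.abs_eq_natAbs]
  exact_mod_cast h₁.trans h₂

/-- In a large cube, the edge boundary is a small proportion of the volume. -/
theorem exists_edgeOpt_le_mul {δ : ℝ} (hδ : 0 < δ) :
    ∃ q : ℕ, 0 < q ∧ (edgeOpt u q : ℝ) ≤ δ * q := by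
  obtain ⟨M, hM⟩ := exists_forall_abs_apply_le u
  obtain ⟨N, hN⟩ := exists_nat_gt (k * (d * (2 * M)) / δ)
  have hcard : ∀ R : ℕ, (Finset.Icc (fun _ : Fin d => -(R : ℤ)) (fun _ => (R : ℤ))).card
      = (2 * R + 1) ^ d := by
    intro R
    rw [Pi.card_Icc]
    simp only [Int.card_Icc, Finset.prod_const, Finset.card_univ, Fintype.card_fin]
    congr 1
    omega
  set C := Finset.Icc (fun _ : Fin d => -((M + N : ℕ) : ℤ)) (fun _ => ((M + N : ℕ) : ℤ)) with hC
  have hCcard : C.card = (2 * (M + N) + 1) ^ d := hcard _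
  have hpos : (0 : ℝ) < 2 * (M + N) + 1 := by positivity
  refine ⟨C.card, by rw [hCcard]; positivity, ?_⟩
  have hdir : ∀ i, ((C.filter (fun v => v + u i ∉ C)).card : ℝ)
      ≤ d * (2 * M) / (2 * (M + N) + 1) * C.card := by
    intro i
    have hsub : Finset.Icc (fun _ : Fin d => -(N : ℤ)) (fun _ => (N : ℤ))
        ⊆ C.filter (fun v => v + u i ∈ C) := by
      intro v hv
      simp only [hC, Finset.mem_filter, Finset.mem_Icc, Pi.le_def, Pi.add_apply] at hv ⊢
      refine ⟨⟨fun j => ?_, fun j => ?_⟩, fun j => ?_, fun j => ?_⟩ <;>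
      · have := abs_le.1 (hM i j)
        have h₁ := hv.1 j
        have h₂ := hv.2 j
        push_cast
        omega
    have h₁ := Finset.card_le_card hsub
    have h₂ := Finset.card_filter_add_card_filter_not (s := C) (fun v => v + u i ∈ C)
    rw [hcard] at h₁
    have h₃ : ((2 * N + 1 : ℕ) : ℝ) ^ d + (C.filter (fun v => v + u i ∉ C)).card ≤ C.card := by
      exact_mod_cast (by omega : (2 * N + 1) ^ d + (C.filter (fun v => v + u i ∉ C)).card ≤ C.card)
    have hb := one_add_mul_le_pow (a := -(2 * M / (2 * (M + N) + 1) : ℝ))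
      (by
        have : (2 * M / (2 * (M + N) + 1) : ℝ) ≤ 1 := by
          rw [div_le_one hpos]
          have : (0 : ℝ) ≤ N := by positivity
          linarith
        linarith) d
    have hbase : (1 + -(2 * M / (2 * (M + N) + 1)) : ℝ) = (2 * N + 1) / (2 * (M + N) + 1) := by
      field_simp
      ring
    have hCreal : (C.card : ℝ) = (2 * (M + N) + 1) ^ d := by rw [hCcard]; push_cast; ring
    rw [hbase, div_pow, ← hCreal, le_div_iff₀ (by rw [hCreal]; positivity)] at hb
    push_cast at h₃
    have : (d * (2 * M) / (2 * (M + N) + 1) * C.card : ℝ)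
      = C.card - (1 + d * -(2 * M / (2 * (M + N) + 1))) * C.card := by ring
    linarith
  calc (edgeOpt u C.card : ℝ) ≤ edgeBdry u C := by exact_mod_cast edgeOpt_card_le u C
    _ ≤ ∑ _i : Fin k, (d * (2 * M) / (2 * (M + N) + 1) * C.card : ℝ) := by
        rw [edgeBdry, Nat.cast_sum]
        exact Finset.sum_le_sum fun i _ => hdir i
    _ = k * (d * (2 * M)) / (2 * (M + N) + 1) * C.card := by
        rw [Finset.sum_const, Finset.card_univ, Fintype.card_fin, nsmul_eq_mul]; ring
    _ ≤ δ * C.card := by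
        gcongr
        rw [div_le_iff₀ hpos]
        rw [div_lt_iff₀ hδ] at hN
        have : (N : ℝ) * δ ≤ δ * (2 * (M + N) + 1) := by
          rw [mul_comm]
          gcongr
          have : (0 : ℝ) ≤ M := by positivity
          have : (0 : ℝ) ≤ N := by positivity
          linarith
        linarith

theorem exists_forall_edgeOpt_le_mul_add [Infinite (Fin d → ℤ)] (hu : ∀ i, u i ≠ 0)
    {δ : ℝ} (hδ : 0 < δ) : ∃ K : ℝ, ∀ r : ℕ, (edgeOpt u r : ℝ) ≤ δ * r + K := by
  obtain ⟨q, hq, hqδ⟩ := exists_edgeOpt_le_mul u hδ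
  refine ⟨edgeOpt u q, fun r => ?_⟩
  have h : edgeOpt u r ≤ r / q * edgeOpt u q + edgeOpt u q :=
    calc edgeOpt u r = edgeOpt u (r / q * q + r % q) := by rw [Nat.div_add_mod']
      _ ≤ edgeOpt u (r / q * q) + edgeOpt u (r % q) := edgeOpt_add_le u _ _
      _ ≤ _ := add_le_add (edgeOpt_mul_le u _ _) (edgeOpt_mono u hu (Nat.mod_lt r hq).le)
  have hr : ((r / q : ℕ) : ℝ) * q ≤ r := by exact_mod_cast Nat.div_mul_le_self r q
  calc (edgeOpt u r : ℝ) ≤ (r / q : ℕ) * edgeOpt u q + edgeOpt u q := by exact_mod_cast h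
    _ ≤ (r / q : ℕ) * (δ * q) + edgeOpt u q := by gcongr
    _ = δ * ((r / q : ℕ) * q) + edgeOpt u q := by ring
    _ ≤ δ * r + edgeOpt u q := by gcongr

/-- Lowering the cardinality by a bounded multiple of the optimal boundary
changes the optimal boundary by a small proportion only. -/
theorem exists_forall_one_sub_mul_edgeOpt_le [Infinite (Fin d → ℤ)] (hu : ∀ i, u i ≠ 0)
    {c δ : ℝ} (hc : 0 < c) (hδ : 0 < δ) :
    ∃ n₀ : ℕ, ∀ n m : ℕ, n₀ ≤ n → (n : ℝ) ≤ m + c * edgeOpt u n →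
      (1 - δ) * edgeOpt u n ≤ (edgeOpt u m : ℝ) := by
  have hmono := edgeOpt_mono u hu
  by_cases hbdd : ∃ B, ∀ n, edgeOpt u n ≤ B
  · obtain ⟨B, hB⟩ := hbdd
    obtain ⟨n₁, hn₁⟩ : ∃ n₁, ∀ n, edgeOpt u n ≤ edgeOpt u n₁ := by
      have hfin : (Set.range (edgeOpt u)).Finite :=
        (Set.finite_Iic B).subset (Set.range_subset_iff.2 hB)
      obtain ⟨_, ⟨n₁, rfl⟩, h⟩ := Set.exists_max_image _ id hfin (Set.range_nonempty _)
      exact ⟨n₁, fun n => h _ ⟨n, rfl⟩⟩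
    obtain ⟨N, hN⟩ := exists_nat_gt (c * B)
    refine ⟨n₁ + N, fun n m hn hnm => ?_⟩
    have hm : n₁ ≤ m := by
      have h₁ : c * edgeOpt u n ≤ c * B := by gcongr; exact hB n
      have h₂ : ((n₁ + N : ℕ) : ℝ) ≤ n := by exact_mod_cast hn
      push_cast at h₂
      exact_mod_cast (by linarith : (n₁ : ℝ) ≤ m)
    have h : (edgeOpt u n : ℝ) ≤ edgeOpt u m := by exact_mod_cast (hn₁ n).trans (hmono hm)
    nlinarith [(Nat.cast_nonneg (edgeOpt u n) : (0 : ℝ) ≤ _)]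
  · push Not at hbdd
    obtain ⟨K, hK⟩ := exists_forall_edgeOpt_le_mul_add u hu
      (show 0 < δ / (2 * c) by positivity)
    obtain ⟨B, hB⟩ := exists_nat_gt (2 * K / δ)
    obtain ⟨n₀, hn₀⟩ := hbdd B
    refine ⟨n₀, fun n m hn hnm => ?_⟩
    have hKn : K ≤ δ / 2 * edgeOpt u n := by
      have : (B : ℝ) ≤ edgeOpt u n := by exact_mod_cast hn₀.le.trans (hmono hn)
      have := hB.trans_le this
      rw [div_lt_iff₀ hδ] at this
      linarith
    rcases le_total n m with h | h
    · have h : (edgeOpt u n : ℝ) ≤ edgeOpt u m := by exact_mod_cast hmono h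
      nlinarith [(Nat.cast_nonneg (edgeOpt u n) : (0 : ℝ) ≤ _)]
    · obtain ⟨r, rfl⟩ := Nat.exists_eq_add_of_le h
      have h₁ : (edgeOpt u (m + r) : ℝ) ≤ edgeOpt u m + edgeOpt u r := by
        exact_mod_cast edgeOpt_add_le u m r
      have h₂ : (r : ℝ) ≤ c * edgeOpt u (m + r) := by
        push_cast at hnm
        linarith
      have h₃ : δ / (2 * c) * r ≤ δ / 2 * edgeOpt u (m + r) := by
        calc δ / (2 * c) * r ≤ δ / (2 * c) * (c * edgeOpt u (m + r)) := by gcongr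
          _ = _ := by field_simp
      have := hK r
      linarith

end EdgeBoundary

theorem pushed_set_boundary_bound (d k : ℕ) (hd : 1 ≤ d)
    (u : Fin k → (Fin d → ℤ)) (hu : ∀ i, u i ≠ 0)
    (hgen : AddSubgroup.closure (Set.range u) = ⊤) :
    ∀ t : ℕ, ∀ ε : ℝ, 0 < ε → ε < 1 →
      ∃ n₀ : ℕ, ∀ S : Finset (Fin d → ℤ), n₀ ≤ S.card →
        (edgeBdry u S : ℝ) ≤ (1 + ε) * (edgeOpt u S.card : ℝ) →
        ∀ x : Fin t → Fin k,
          (edgeBdry u (S + ∑ j, ({0, u (x j)} : Finset (Fin d → ℤ))) : ℝ)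
            ≤ (1 + 2 * 3 ^ t * ε) * (edgeOpt u S.card : ℝ) := by
  have : Nonempty (Fin d) := ⟨⟨0, hd⟩⟩
  have : Infinite (Fin d → ℤ) := inferInstance
  intro t ε hε hε1
  induction t with
  | zero =>
    refine ⟨0, fun S _ hS x => ?_⟩
    rw [Finset.univ_eq_empty, Finset.sum_empty, add_zero]
    refine hS.trans ?_
    gcongr
    linarith
  | succ t ih =>
    obtain ⟨n₁, hn₁⟩ := ih
    obtain ⟨n₂, hn₂⟩ := exists_forall_one_sub_mul_edgeOpt_le u hu
      (show 0 < 1 + 2 * 3 ^ t * ε by positivity) (show 0 < 2 * 3 ^ t * ε by positivity)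
    refine ⟨max n₁ n₂, fun S hn hS x => ?_⟩
    rw [Fin.sum_univ_castSucc, ← add_assoc, add_pair_zero_eq_union_image]
    have hT := hn₁ S (le_of_max_le_left hn) hS (fun j => x j.castSucc)
    set T := S + ∑ j : Fin t, ({0, u (x j.castSucc)} : Finset (Fin d → ℤ)) with hTdef
    set v := u (x (Fin.last t)) with hv
    have hST : S.card ≤ T.card :=
      Finset.card_le_card_add_right <| Finset.sum_induction _ Finset.Nonempty
        (fun _ _ => Finset.Nonempty.add) ⟨0, by simp⟩ fun j _ => ⟨0, by simp⟩
    have hinter : (T.card : ℝ) ≤ (T ∩ T.image (· + v)).card + edgeBdry u T := by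
      exact_mod_cast card_le_card_inter_image_add_edgeBdry u (x (Fin.last t)) T
    have hopt := hn₂ S.card (T ∩ T.image (· + v)).card (le_of_max_le_right hn) (by
      have : (S.card : ℝ) ≤ T.card := by exact_mod_cast hST
      linarith)
    have hle : (edgeOpt u (T ∩ T.image (· + v)).card : ℝ) ≤ edgeBdry u (T ∩ T.image (· + v)) := by
      exact_mod_cast edgeOpt_card_le u _
    have hsub : (edgeBdry u (T ∪ T.image (· + v)) : ℝ) + edgeBdry u (T ∩ T.image (· + v))
        ≤ edgeBdry u T + edgeBdry u T := by
      have := edgeBdry_union_add_edgeBdry_inter_le u T (T.image (· + v))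
      rw [edgeBdry_image_add_right] at this
      exact_mod_cast this
    rw [pow_succ]
    linarith
end

section
/- Let d ≥ 1, let U = {u_1, …, u_k} be a finite set of non-zero vectors in ℤ^d, let Z_0 = {0,u_1} + ⋯ + {0,u_k} ⊆ ℤ^d, let Z be the convex hull of Z_0 in ℝ^d, and for t ∈ ℕ let Z(t) = (t·Z) ∩ ℤ^d. If S ⊆ ℤ^d is finite and Z(t) ⊆ S, then the edge boundary satisfies ∂(S) ≥ ∂(Z(t)). -/
open Pointwise

/-- A ray with non-zero direction starting in a finite set of lattice points leaves the set. -/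
lemma exists_mem_add_nsmul_and_notMem {d : ℕ} {w : Fin d → ℤ} (hw : w ≠ 0)
    {S : Finset (Fin d → ℤ)} {v : Fin d → ℤ} (hv : v ∈ S) :
    ∃ n : ℕ, v + n • w ∈ S ∧ v + n • w + w ∉ S := by
  by_contra! h
  have hmem : ∀ n : ℕ, v + n • w ∈ S := by
    intro n
    induction n with
    | zero => simpa using hv
    | succ n ih =>
      rw [succ_nsmul, ← add_assoc]
      exact h n ih
  have hinj : Function.Injective (fun n : ℕ => v + n • w) := by
    intro m n hmn
    obtain ⟨j, hj⟩ := Function.ne_iff.mp hw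
    have hmul : (m : ℤ) * w j = n * w j := by simpa using congrFun hmn j
    exact_mod_cast mul_right_cancel₀ hj hmul
  exact Set.infinite_univ ((S.finite_toSet.preimage hinj.injOn).subset fun n _ => hmem n)

/-- If `A` meets every line in direction `w` in an interval, then every finite superset of `A` has
at least as many boundary edges in direction `w`. -/
lemma card_filter_add_notMem_le {d : ℕ} {w : Fin d → ℤ} (hw : w ≠ 0)
    {A S : Finset (Fin d → ℤ)} (hAS : A ⊆ S)
    (hA : ∀ v ∈ A, ∀ n : ℕ, v + (n + 1) • w ∈ A → v + w ∈ A) :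
    (A.filter (fun v => v + w ∉ A)).card ≤ (S.filter (fun v => v + w ∉ S)).card := by
  choose! n hn using fun v (hv : v ∈ S) => exists_mem_add_nsmul_and_notMem hw hv
  have le_of_eq : ∀ v ∈ A, v + w ∉ A → ∀ v' ∈ A, v + n v • w = v' + n v' • w → n v ≤ n v' := by
    intro v hv hvw v' hv' heq
    by_contra! hlt
    obtain ⟨m, hm⟩ := Nat.exists_eq_add_of_lt hlt
    refine hvw (hA v hv m ?_)
    have : v + (m + 1) • w = v' := by
      rw [hm, add_assoc, add_comm (n v'), add_nsmul, ← add_assoc] at heq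
      exact add_right_cancel heq
    rwa [this]
  refine Finset.card_le_card_of_injOn (fun v => v + n v • w) ?_ ?_
  · intro v hv
    simp only [Finset.coe_filter, Set.mem_ofPred_eq] at hv ⊢
    exact hn v (hAS hv.1)
  · intro v hv v' hv' heq
    simp only [Finset.coe_filter, Set.mem_ofPred_eq] at hv hv'
    have hnn := le_antisymm (le_of_eq v hv.1 hv.2 v' hv'.1 heq)
      (le_of_eq v' hv'.1 hv'.2 v hv.1 heq.symm)
    simpa [hnn] using heq

/-- The lattice points of a convex set meet every line in an interval. -/
lemma toReal'_add_mem_of_convex {d : ℕ} {C : Set (Fin d → ℝ)} (hC : Convex ℝ C)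
    {v w : Fin d → ℤ} {n : ℕ} (hv : toReal' v ∈ C) (hvw : toReal' (v + (n + 1) • w) ∈ C) :
    toReal' (v + w) ∈ C := by
  have hn : (0 : ℝ) < n + 1 := by positivity
  convert hC.add_smul_sub_mem hv hvw (t := 1 / ((n : ℝ) + 1))
    ⟨by positivity, (div_le_one hn).mpr (by simp)⟩ using 1
  ext j
  simp [toReal']
  field_simp

theorem scaled_zonotope_minimizes_over_supersets (d k : ℕ) (hd : 1 ≤ d)
    (u : Fin k → (Fin d → ℤ)) (hu : ∀ i, u i ≠ 0)
    (Z0 : Finset (Fin d → ℤ))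
    (hZ0 : Z0 = ∑ i, ({0, u i} : Finset (Fin d → ℤ)))
    (Z : Set (Fin d → ℝ))
    (hZ : Z = convexHull ℝ (toReal' '' (Z0 : Set (Fin d → ℤ))))
    (t : ℕ)
    (Zt : Finset (Fin d → ℤ)) (hZt : ∀ v, v ∈ Zt ↔ toReal' v ∈ (t : ℝ) • Z)
    (S : Finset (Fin d → ℤ)) (hS : Zt ⊆ S) :
    edgeBdry u Zt ≤ edgeBdry u S := by
  have hC : Convex ℝ ((t : ℝ) • Z) := by
    rw [hZ]
    exact (convex_convexHull ℝ _).smul _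
  refine Finset.sum_le_sum fun i _ => card_filter_add_notMem_le (hu i) hS fun v hv n hvn => ?_
  rw [hZt] at hv hvn ⊢
  exact toReal'_add_mem_of_convex hC hv hvn
end
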